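/- arXiv:2012.15805 — 4 statements merged into one kernel-verified Lean document; each statement's English description precedes it below -/
import Mathlib

section
/- For every real x > 0, the functions J and F satisfy J(x) = F(2x) − 2F(x) + F(x/2) + π²/(12x). -/
open Real MeasureTheory

/-- The digamma function ψ = Γ′/Γ. -/
noncomputable def digamma (x : ℝ) : ℝ := deriv Real.Gamma x / Real.Gamma x

/-- The Herglotz function F(x) = ∑_{n≥1} (ψ(nx) − log(nx))/n. -/
noncomputable def herglotzF (x : ℝ) : ℝ :=
  ∑' n : ℕ, (digamma (((n : ℝ) + 1) * x) - Real.log (((n : ℝ) + 1) * x)) / ((n : ℝ) + 1)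

/-- J(x) = ∫₀¹ log(1+tˣ)/(1+t) dt. -/
noncomputable def Jfun (x : ℝ) : ℝ := ∫ t in (0:ℝ)..1, Real.log (1 + t ^ x) / (1 + t)

open Filter Topology Set

lemma hasDerivAt_log_Gamma {y : ℝ} (hy : 0 < y) :
    HasDerivAt (Real.log ∘ Real.Gamma) (digamma y) y :=
  (Real.differentiableAt_Gamma fun m ↦ by
    have : (0 : ℝ) ≤ m := m.cast_nonneg
    linarith).hasDerivAt.log (Real.Gamma_pos_of_pos hy).ne'

lemma log_Gamma_add_one {y : ℝ} (hy : 0 < y) :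
    Real.log (Real.Gamma (y + 1)) = Real.log y + Real.log (Real.Gamma y) := by
  rw [Real.Gamma_add_one hy.ne', Real.log_mul hy.ne' (Real.Gamma_pos_of_pos hy).ne']

lemma digamma_add_one {y : ℝ} (hy : 0 < y) : digamma (y + 1) = digamma y + 1 / y := by
  have h1 : HasDerivAt (fun z ↦ (Real.log ∘ Real.Gamma) (z + 1)) (digamma (y + 1)) y :=
    (hasDerivAt_log_Gamma (by linarith)).comp_add_const y 1
  have h2 := (Real.hasDerivAt_log hy.ne').add (hasDerivAt_log_Gamma hy)
  have h3 := h2.congr_of_eventuallyEq (f₁ := fun z ↦ (Real.log ∘ Real.Gamma) (z + 1)) (by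
    filter_upwards [lt_mem_nhds hy] with z hz using log_Gamma_add_one hz)
  rw [h1.unique h3, one_div, add_comm]

lemma digamma_le_log {y : ℝ} (hy : 0 < y) : digamma y ≤ Real.log y := by
  have h := Real.convexOn_log_Gamma.le_slope_of_hasDerivAt (x := y) (y := y + 1)
    hy (show 0 < y + 1 by linarith) (by linarith) (hasDerivAt_log_Gamma hy)
  simpa [slope_def_field, log_Gamma_add_one hy] using h

lemma log_le_digamma_add {y : ℝ} (hy : 0 < y) : Real.log y ≤ digamma y + 1 / y := by
  have h := Real.convexOn_log_Gamma.slope_le_of_hasDerivAt (x := y) (y := y + 1)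
    hy (show 0 < y + 1 by linarith) (by linarith) (hasDerivAt_log_Gamma (by linarith))
  rw [digamma_add_one hy] at h
  simpa [slope_def_field, log_Gamma_add_one hy] using h

lemma abs_digamma_sub_log_le {y : ℝ} (hy : 0 < y) : |digamma y - Real.log y| ≤ 1 / y := by
  have h1 := digamma_le_log hy
  have h2 := log_le_digamma_add hy
  rw [abs_le]
  constructor <;> linarith [one_div_pos.2 hy]

lemma intervalIntegrable_rpow_div_one_add {a : ℝ} (ha : 0 ≤ a) :
    IntervalIntegrable (fun t : ℝ ↦ t ^ a / (1 + t)) volume 0 1 := by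
  apply ContinuousOn.intervalIntegrable
  intro t ht
  rw [uIcc_of_le zero_le_one] at ht
  have : 1 + t ≠ 0 := by linarith [ht.1]
  exact ((Real.continuousAt_rpow_const _ _ (Or.inr ha)).div (by fun_prop) this).continuousWithinAt

lemma integral_zero_one_rpow {a : ℝ} (ha : 0 ≤ a) :
    ∫ t in (0:ℝ)..1, t ^ a = 1 / (a + 1) := by
  rw [integral_rpow (Or.inl (by linarith)), Real.one_rpow, Real.zero_rpow (by linarith), sub_zero]

lemma integral_rpow_div_one_add_nonneg (a : ℝ) : 0 ≤ ∫ t in (0:ℝ)..1, t ^ a / (1 + t) := by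
  apply intervalIntegral.integral_nonneg zero_le_one
  intro t ht
  have := ht.1
  positivity

lemma integral_rpow_div_one_add_le {a : ℝ} (ha : 0 < a) :
    ∫ t in (0:ℝ)..1, t ^ a / (1 + t) ≤ 1 / a := by
  calc _ ≤ ∫ t in (0:ℝ)..1, t ^ a := by
        apply intervalIntegral.integral_mono_on zero_le_one
          (intervalIntegrable_rpow_div_one_add ha.le)
          (intervalIntegral.intervalIntegrable_rpow' (by linarith))
        intro t ht
        have := ht.1
        exact div_le_self (by positivity) (by linarith)
    _ = 1 / (a + 1) := integral_zero_one_rpow ha.le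
    _ ≤ 1 / a := one_div_le_one_div_of_le ha (by linarith)

lemma integral_rpow_div_one_add_sub {a : ℝ} (ha : 0 < a) :
    (∫ t in (0:ℝ)..1, t ^ a / (1 + t)) - ∫ t in (0:ℝ)..1, t ^ (a + 2) / (1 + t) =
      1 / (a + 1) - 1 / (a + 2) := by
  rw [← intervalIntegral.integral_sub (intervalIntegrable_rpow_div_one_add ha.le)
    (intervalIntegrable_rpow_div_one_add (by linarith))]
  have h : ∫ t in (0:ℝ)..1, (t ^ a / (1 + t) - t ^ (a + 2) / (1 + t)) =
      ∫ t in (0:ℝ)..1, (t ^ a - t ^ (a + 1)) := by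
    apply intervalIntegral.integral_congr
    intro t ht
    rw [uIcc_of_le zero_le_one] at ht
    have h0 := ht.1
    have h1 : t ^ (a + 1) = t ^ a * t := by
      rw [Real.rpow_add_of_nonneg h0 ha.le zero_le_one, Real.rpow_one]
    have h2 : t ^ (a + 2) = t ^ a * t ^ 2 := by
      rw [Real.rpow_add_of_nonneg h0 ha.le zero_le_two, Real.rpow_two]
    have : 1 + t ≠ 0 := by linarith
    simp only [h1, h2]
    field_simp
    ring
  rw [h, intervalIntegral.integral_sub
    (intervalIntegral.intervalIntegrable_rpow' (by linarith))
    (intervalIntegral.intervalIntegrable_rpow' (by linarith)),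
    integral_zero_one_rpow ha.le, integral_zero_one_rpow (by linarith)]
  ring_nf

/-- A function on the positive reals of period 2 which is `O(1 / a)` vanishes. -/
lemma eq_zero_of_periodic_of_abs_le {d : ℝ → ℝ} {C : ℝ} (hp : ∀ a, 0 < a → d (a + 2) = d a)
    (hb : ∀ a, 0 < a → |d a| ≤ C / a) {a : ℝ} (ha : 0 < a) : d a = 0 := by
  have hn : ∀ n : ℕ, d (a + 2 * n) = d a := by
    intro n
    induction n with
    | zero => simp
    | succ n ih =>
      rw [← ih, ← hp (a + 2 * n) (by positivity)]
      push_cast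
      ring_nf
  have hlim : Tendsto (fun n : ℕ ↦ C / (a + 2 * n)) atTop (𝓝 0) := by
    apply Tendsto.const_div_atTop
    exact tendsto_atTop_add_const_left _ _
      (tendsto_natCast_atTop_atTop.const_mul_atTop (by norm_num))
  have : |d a| ≤ 0 := ge_of_tendsto' hlim fun n ↦ by
    have := hb (a + 2 * n) (by positivity)
    rwa [hn] at this
  exact abs_eq_zero.1 (le_antisymm this (abs_nonneg _))

lemma integral_rpow_div_one_add_eq {a : ℝ} (ha : 0 < a) :
    ∫ t in (0:ℝ)..1, t ^ a / (1 + t) =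
      (digamma (a / 2) - Real.log (a / 2)) - (digamma a - Real.log a) + 1 / a := by
  have key := eq_zero_of_periodic_of_abs_le (C := 5) (d := fun a ↦
    (∫ t in (0:ℝ)..1, t ^ a / (1 + t)) -
      ((digamma (a / 2) - Real.log (a / 2)) - (digamma a - Real.log a) + 1 / a)) ?_ ?_ ha
  · exact sub_eq_zero.1 key
  · intro a ha
    have h1 := integral_rpow_div_one_add_sub ha
    have h2 : digamma ((a + 2) / 2) = digamma (a / 2) + 2 / a := by
      rw [show (a + 2) / 2 = a / 2 + 1 by ring, digamma_add_one (by positivity), one_div_div]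
    have h3 : digamma (a + 2) = digamma a + 1 / a + 1 / (a + 1) := by
      rw [show a + 2 = a + 1 + 1 by ring, digamma_add_one (by positivity), digamma_add_one ha]
    have h4 : 2 / a = 1 / a + 1 / a := by ring
    simp only [h2, h3, Real.log_div ha.ne' two_ne_zero,
      Real.log_div (show a + 2 ≠ 0 by positivity) two_ne_zero]
    linarith
  · intro a ha
    have h1 := integral_rpow_div_one_add_nonneg a
    have h2 := integral_rpow_div_one_add_le ha
    have h3 := abs_le.1 (abs_digamma_sub_log_le ha)
    have h4 := abs_le.1 (abs_digamma_sub_log_le (half_pos ha))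
    have h5 : 1 / (a / 2) = 2 * (1 / a) := by rw [one_div_div]; ring
    have h6 : 5 / a = 5 * (1 / a) := by ring
    have h7 : 0 < 1 / a := by positivity
    rw [h5] at h4
    rw [h6, abs_le]
    constructor <;> linarith [h3.1, h3.2, h4.1, h4.2]

lemma hasSum_log_one_add_rpow {x t : ℝ} (hx : 0 < x) (ht0 : 0 ≤ t) (ht1 : t < 1) :
    HasSum (fun n : ℕ ↦ (-1) ^ n / ((n : ℝ) + 1) * t ^ (((n : ℝ) + 1) * x))
      (Real.log (1 + t ^ x)) := by
  have h0 : 0 ≤ t ^ x := by positivity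
  have h1 : t ^ x < 1 := Real.rpow_lt_one ht0 ht1 hx
  have h := (Real.hasSum_pow_div_log_of_abs_lt_one (x := -t ^ x)
    (by rw [abs_neg, abs_of_nonneg h0]; exact h1)).neg
  rw [neg_neg, sub_neg_eq_add] at h
  convert! h using 2 with n
  rw [mul_comm _ x, Real.rpow_mul ht0, ← Nat.cast_add_one, Real.rpow_natCast, neg_pow (t ^ x)]
  ring

lemma summable_one_div_add_one_sq : Summable fun n : ℕ ↦ 1 / ((n : ℝ) + 1) ^ 2 := by
  have := (summable_nat_add_iff 1).2 hasSum_zeta_two.summable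
  simpa using this

lemma tsum_one_div_add_one_sq : ∑' n : ℕ, 1 / ((n : ℝ) + 1) ^ 2 = Real.pi ^ 2 / 6 := by
  have h := hasSum_zeta_two.summable.tsum_eq_zero_add
  rw [hasSum_zeta_two.tsum_eq] at h
  simpa using h.symm

lemma summable_div_add_one_of_abs_le {f : ℝ → ℝ} {C x : ℝ} (hx : 0 < x)
    (hf : ∀ y, 0 < y → |f y| ≤ C / y) :
    Summable fun n : ℕ ↦ f (((n : ℝ) + 1) * x) / ((n : ℝ) + 1) := by
  refine Summable.of_norm_bounded (summable_one_div_add_one_sq.mul_left (C / x)) fun n ↦ ?_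
  have hn : (0 : ℝ) < (n : ℝ) + 1 := by positivity
  rw [Real.norm_eq_abs, abs_div, abs_of_pos hn]
  calc _ ≤ C / (((n : ℝ) + 1) * x) / ((n : ℝ) + 1) := by
        gcongr
        exact hf _ (by positivity)
    _ = _ := by field_simp

lemma Jfun_eq_tsum {x : ℝ} (hx : 0 < x) :
    Jfun x = ∑' n : ℕ, (-1) ^ n *
      ((∫ t in (0:ℝ)..1, t ^ (((n : ℝ) + 1) * x) / (1 + t)) / ((n : ℝ) + 1)) := by
  set F : ℕ → ℝ → ℝ := fun n t ↦
    (-1) ^ n / ((n : ℝ) + 1) * (t ^ (((n : ℝ) + 1) * x) / (1 + t)) with hF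
  have hFint : ∀ n, Integrable (F n) (volume.restrict (Ioc 0 1)) := fun n ↦ by
    have := (intervalIntegrable_rpow_div_one_add (a := ((n : ℝ) + 1) * x) (by positivity)).1
    exact this.const_mul _
  have hnorm : ∀ n, ∫ t in Ioc (0:ℝ) 1, ‖F n t‖ =
      (∫ t in (0:ℝ)..1, t ^ (((n : ℝ) + 1) * x) / (1 + t)) / ((n : ℝ) + 1) := fun n ↦ by
    rw [intervalIntegral.integral_of_le zero_le_one, ← integral_div]
    refine setIntegral_congr_fun measurableSet_Ioc fun t ht ↦ ?_
    have h0 : 0 < t := ht.1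
    have h1 : 0 ≤ t ^ (((n : ℝ) + 1) * x) / (1 + t) := by positivity
    have hn : (0 : ℝ) < (n : ℝ) + 1 := by positivity
    simp only [hF, norm_mul, norm_div, norm_pow, norm_neg, norm_one, one_pow]
    rw [← norm_div, Real.norm_of_nonneg h1, Real.norm_of_nonneg hn.le]
    ring
  have hsum := hasSum_integral_of_summable_integral_norm hFint (by
    simp only [hnorm]
    exact summable_div_add_one_of_abs_le (C := 1)
      (f := fun a ↦ ∫ t in (0:ℝ)..1, t ^ a / (1 + t)) hx fun y hy ↦ by
        rw [abs_of_nonneg (integral_rpow_div_one_add_nonneg y)]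
        exact integral_rpow_div_one_add_le hy)
  have hJ : Jfun x = ∫ t in Ioc (0:ℝ) 1, ∑' n, F n t := by
    rw [Jfun, intervalIntegral.integral_of_le zero_le_one, integral_Ioc_eq_integral_Ioo,
      integral_Ioc_eq_integral_Ioo]
    refine setIntegral_congr_fun measurableSet_Ioo fun t ht ↦ ?_
    have h := (hasSum_log_one_add_rpow hx ht.1.le ht.2).div_const (1 + t)
    simp only [mul_div_assoc] at h
    exact h.tsum_eq.symm
  rw [hJ, ← hsum.tsum_eq]
  refine tsum_congr fun n ↦ ?_
  simp only [hF]
  rw [integral_const_mul, intervalIntegral.integral_of_le zero_le_one]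
  ring

lemma tsum_neg_one_pow_mul {b : ℕ → ℝ} (hb : Summable b) :
    ∑' n, (-1) ^ n * b n = ∑' n, b n - 2 * ∑' n, b (2 * n + 1) := by
  have he : Summable fun n ↦ b (2 * n) :=
    hb.comp_injective (i := fun n : ℕ ↦ 2 * n) fun m n h ↦ by simpa using h
  have ho : Summable fun n ↦ b (2 * n + 1) :=
    hb.comp_injective (i := fun n : ℕ ↦ 2 * n + 1) fun m n h ↦ by simpa using h
  have he' : ∀ n : ℕ, (-1) ^ (2 * n) * b (2 * n) = b (2 * n) := fun n ↦ by simp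
  have ho' : ∀ n : ℕ, (-1) ^ (2 * n + 1) * b (2 * n + 1) = -b (2 * n + 1) :=
    fun n ↦ by simp [pow_succ]
  rw [← tsum_even_add_odd he ho, ← tsum_even_add_odd (f := fun n ↦ (-1) ^ n * b n)
    (by simpa only [he'] using he) (by simpa only [ho'] using ho.neg)]
  simp only [he', ho', tsum_neg]
  ring

theorem J_eq_F_combination (x : ℝ) (hx : 0 < x) :
    Jfun x = herglotzF (2 * x) - 2 * herglotzF x + herglotzF (x / 2)
      + Real.pi ^ 2 / (12 * x) := by
  have hF : ∀ y, 0 < y → HasSum (fun n : ℕ ↦ (digamma (((n : ℝ) + 1) * y)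
      - Real.log (((n : ℝ) + 1) * y)) / ((n : ℝ) + 1)) (herglotzF y) := fun y hy ↦
    (summable_div_add_one_of_abs_le (f := fun z ↦ digamma z - Real.log z) (C := 1) hy
      fun z hz ↦ abs_digamma_sub_log_le hz).hasSum
  have hz : HasSum (fun n : ℕ ↦ 1 / ((n : ℝ) + 1) ^ 2) (Real.pi ^ 2 / 6) :=
    tsum_one_div_add_one_sq ▸ summable_one_div_add_one_sq.hasSum
  have hall := ((hF _ (half_pos hx)).sub (hF x hx)).add (hz.mul_left (1 / x))
  have hodd := (((hF x hx).sub (hF (2 * x) (by positivity))).add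
    (hz.mul_left (1 / (2 * x)))).mul_left (1 / 2)
  rw [Jfun_eq_tsum hx]
  set b : ℕ → ℝ := fun n ↦
    (∫ t in (0:ℝ)..1, t ^ (((n : ℝ) + 1) * x) / (1 + t)) / ((n : ℝ) + 1) with hb
  have hb_sum : HasSum b (herglotzF (x / 2) - herglotzF x + 1 / x * (Real.pi ^ 2 / 6)) := by
    convert! hall using 2 with n
    simp only [hb]
    rw [integral_rpow_div_one_add_eq (by positivity), mul_div_assoc]
    field_simp
  have hb_odd : HasSum (fun n ↦ b (2 * n + 1))
      (1 / 2 * (herglotzF x - herglotzF (2 * x) + 1 / (2 * x) * (Real.pi ^ 2 / 6))) := by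
    convert! hodd using 2 with n
    simp only [hb]
    rw [integral_rpow_div_one_add_eq (by positivity)]
    push_cast
    rw [show (2 * (n : ℝ) + 1 + 1) * x / 2 = ((n : ℝ) + 1) * x by ring,
      show (2 * (n : ℝ) + 1 + 1) * x = ((n : ℝ) + 1) * (2 * x) by ring,
      show 2 * (n : ℝ) + 1 + 1 = 2 * ((n : ℝ) + 1) by ring]
    field_simp
  rw [tsum_neg_one_pow_mul hb_sum.summable, hb_sum.tsum_eq, hb_odd.tsum_eq]
  field_simp
  ring
end

section
/- J(1+√2) = −π²/24 + (log 2)²/2 + (log 2 · log(1+√2))/2. -/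
open Real MeasureTheory

open Set Filter Topology

/-- The Fermi–Dirac kernel `1 / (eˢ + 1)`. -/
noncomputable def fermi (s : ℝ) : ℝ := 1 / (exp s + 1)

/-- The Bose–Einstein kernel `1 / (eˢ - 1)`. -/
noncomputable def bose (s : ℝ) : ℝ := 1 / (exp s - 1)

/-- `log (1 + e⁻ˢ)`, an antiderivative of `-fermi`. -/
noncomputable def logFermi (s : ℝ) : ℝ := log (1 + exp (-s))

/-- `log (1 - e⁻ˢ)`, an antiderivative of `bose` on `(0, ∞)`. -/
noncomputable def logBose (s : ℝ) : ℝ := log (1 - exp (-s))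

/-- `∫₀^∞ log (1 + e^(-xs)) / (eˢ + 1) ds`, which is `Jfun x` after the substitution `t = e⁻ˢ`. -/
noncomputable def fermiIntegral (x : ℝ) : ℝ := ∫ s in Ioi 0, logFermi (x * s) * fermi s

/-- `∫₀^∞ log (1 - e^(-xs)) / (eˢ + 1) ds`, the companion of `fermiIntegral`. -/
noncomputable def boseIntegral (x : ℝ) : ℝ := ∫ s in Ioi 0, logBose (x * s) * fermi s

@[fun_prop] lemma measurable_fermi : Measurable fermi := by
  unfold fermi; fun_prop

@[fun_prop] lemma measurable_bose : Measurable bose := by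
  unfold bose; fun_prop

@[fun_prop] lemma measurable_logFermi : Measurable logFermi := by
  unfold logFermi; fun_prop

@[fun_prop] lemma measurable_logBose : Measurable logBose := by
  unfold logBose; fun_prop

lemma fermi_pos (s : ℝ) : 0 < fermi s := by
  unfold fermi; positivity

lemma fermi_le_exp_neg (s : ℝ) : fermi s ≤ exp (-s) := by
  rw [fermi, exp_neg, ← one_div]
  exact one_div_le_one_div_of_le (exp_pos s) (by linarith)

lemma bose_pos {s : ℝ} (hs : 0 < s) : 0 < bose s := by
  have := add_one_lt_exp hs.ne'
  exact one_div_pos.2 (by linarith)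

lemma mul_bose_le_one {s : ℝ} (hs : 0 < s) : s * bose s ≤ 1 := by
  have := add_one_lt_exp hs.ne'
  rw [bose, mul_one_div, div_le_one (by linarith)]
  linarith

lemma fermi_eq_bose_sub {s : ℝ} (hs : 0 < s) : fermi s = bose s - 2 * bose (2 * s) := by
  have h1 := add_one_lt_exp hs.ne'
  have h2 : exp (2 * s) - 1 = (exp s - 1) * (exp s + 1) := by
    rw [two_mul, exp_add]; ring
  have h3 : exp s - 1 ≠ 0 := by linarith
  have h4 : exp s + 1 ≠ 0 := by linarith
  rw [fermi, bose, bose, h2]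
  field_simp
  ring

lemma mul_fermi_le_one {s : ℝ} (hs : 0 < s) : s * fermi s ≤ 1 := by
  have h1 := fermi_eq_bose_sub hs
  have h2 := bose_pos (mul_pos two_pos hs)
  nlinarith [mul_bose_le_one hs]

/-- The addition law linking the two kernels. -/
lemma fermi_mul_fermi {a b : ℝ} (h : 0 < a + b) :
    fermi a * fermi b = bose (a + b) * (1 - fermi a - fermi b) := by
  have h1 := add_one_lt_exp h.ne'
  have h3 : exp a * exp b - 1 ≠ 0 := by rw [← exp_add]; linarith
  rw [fermi, fermi, bose, exp_add]
  field_simp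
  ring

lemma fermi_neg (s : ℝ) : fermi (-s) = 1 - fermi s := by
  rw [fermi, fermi, exp_neg]
  field_simp
  ring

lemma hasDerivAt_logFermi (s : ℝ) : HasDerivAt logFermi (-fermi s) s := by
  have h := ((hasDerivAt_neg s).exp.const_add 1).log (by positivity)
  refine h.congr_deriv ?_
  rw [fermi, exp_neg]
  field_simp

lemma hasDerivAt_logBose {s : ℝ} (hs : 0 < s) : HasDerivAt logBose (bose s) s := by
  have h1 : exp (-s) < 1 := exp_lt_one_iff.2 (by linarith)
  have h := ((hasDerivAt_neg s).exp.const_sub 1).log (by linarith)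
  refine h.congr_deriv ?_
  have h2 := add_one_lt_exp hs.ne'
  have h3 : exp s - 1 ≠ 0 := by linarith
  rw [bose, exp_neg]
  field_simp

lemma logFermi_nonneg (s : ℝ) : 0 ≤ logFermi s :=
  log_nonneg (by linarith [exp_pos (-s)])

lemma logFermi_le_exp_neg (s : ℝ) : logFermi s ≤ exp (-s) := by
  have := log_le_sub_one_of_pos (show 0 < 1 + exp (-s) by positivity)
  rw [logFermi]; linarith

lemma abs_logBose_le {s : ℝ} (hs : 0 < s) : |logBose s| ≤ 2 * s ^ ((1 / 2 : ℝ) - 1) := by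
  have h1 : exp (-s) < 1 := exp_lt_one_iff.2 (by linarith)
  have hp := exp_pos (-s)
  have h2 : (1 - exp (-s))⁻¹ ≤ 1 + s⁻¹ := by
    have h := add_one_lt_exp hs.ne'
    have hs' : (1 - exp (-s))⁻¹ = 1 + (exp s - 1)⁻¹ := by
      have h3 : exp s - 1 ≠ 0 := by linarith
      rw [exp_neg]
      field_simp
      ring
    rw [hs']
    gcongr
    linarith
  have h4 : s ^ ((1 / 2 : ℝ) - 1) = √s⁻¹ := by
    rw [sqrt_eq_rpow, inv_rpow hs.le, ← rpow_neg hs.le]; norm_num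
  rw [h4, logBose, abs_of_nonpos (log_nonpos (by linarith) (by linarith)), ← log_inv]
  have h5 : 1 + s⁻¹ ≤ (1 + √s⁻¹) ^ 2 := by
    nlinarith [sq_sqrt (inv_pos.2 hs).le, sqrt_nonneg s⁻¹]
  have hpos : 0 < 1 + √s⁻¹ := by positivity
  calc log (1 - exp (-s))⁻¹ ≤ log ((1 + √s⁻¹) ^ 2) :=
        log_le_log (inv_pos.2 (by linarith)) (h2.trans h5)
    _ = 2 * log (1 + √s⁻¹) := by rw [log_pow]; norm_num
    _ ≤ 2 * √s⁻¹ := by linarith [log_le_sub_one_of_pos hpos]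

lemma integrableOn_exp_neg : IntegrableOn (fun s : ℝ ↦ exp (-s)) (Ioi 0) :=
  integrableOn_exp_neg_Ioi 0

lemma integrableOn_logFermi_mul_fermi {x : ℝ} (hx : 0 < x) :
    IntegrableOn (fun s ↦ logFermi (x * s) * fermi s) (Ioi 0) := by
  refine Integrable.mono' integrableOn_exp_neg (by fun_prop) ?_
  filter_upwards [ae_restrict_mem measurableSet_Ioi] with s (hs : 0 < s)
  rw [norm_eq_abs, abs_of_nonneg (mul_nonneg (logFermi_nonneg _) (fermi_pos s).le),
    ← one_mul (exp (-s))]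
  refine mul_le_mul ((logFermi_le_exp_neg _).trans ?_) (fermi_le_exp_neg s) (fermi_pos s).le
    zero_le_one
  exact exp_le_one_iff.2 (by nlinarith)

lemma integrableOn_logBose_mul_fermi {x : ℝ} (hx : 0 < x) :
    IntegrableOn (fun s ↦ logBose (x * s) * fermi s) (Ioi 0) := by
  refine Integrable.mono' ((GammaIntegral_convergent (one_half_pos (α := ℝ))).const_mul
    (2 * x ^ ((1 / 2 : ℝ) - 1))) (by fun_prop) ?_
  filter_upwards [ae_restrict_mem measurableSet_Ioi] with s (hs : 0 < s)
  rw [norm_eq_abs, abs_mul, abs_of_pos (fermi_pos s)]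
  calc |logBose (x * s)| * fermi s ≤ (2 * (x * s) ^ ((1 / 2 : ℝ) - 1)) * exp (-s) :=
        mul_le_mul (abs_logBose_le (mul_pos hx hs)) (fermi_le_exp_neg s) (fermi_pos s).le
          (by positivity)
    _ = _ := by rw [mul_rpow hx.le hs.le]; ring

lemma hasDerivAt_integral_comp_mul_mul_fermi {F f : ℝ → ℝ} (hF : Measurable F)
    (hf : Measurable f) (hd : ∀ s, 0 < s → HasDerivAt F (f s) s)
    (hb : ∀ s, 0 < s → |s * f s| ≤ 1) {x : ℝ} (hx : 0 < x)
    (hint : IntegrableOn (fun s ↦ F (x * s) * fermi s) (Ioi 0)) :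
    IntegrableOn (fun s ↦ s * f (x * s) * fermi s) (Ioi 0) ∧
      HasDerivAt (fun y ↦ ∫ s in Ioi 0, F (y * s) * fermi s)
        (∫ s in Ioi 0, s * f (x * s) * fermi s) x := by
  refine hasDerivAt_integral_of_dominated_loc_of_deriv_le
    (F := fun y s ↦ F (y * s) * fermi s) (F' := fun y s ↦ s * f (y * s) * fermi s)
    (bound := fun s ↦ (x / 2)⁻¹ * exp (-s))
    (Ioi_mem_nhds (half_lt_self hx)) (.of_forall fun y ↦ by fun_prop) hint (by fun_prop) ?_
    (integrableOn_exp_neg.const_mul _) ?_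
  · filter_upwards [ae_restrict_mem measurableSet_Ioi] with s (hs : 0 < s) y (hy : x / 2 < y)
    have hy0 : 0 < y := (half_pos hx).trans hy
    rw [norm_eq_abs, abs_mul, abs_of_pos (fermi_pos s)]
    refine mul_le_mul ?_ (fermi_le_exp_neg s) (fermi_pos s).le (by positivity)
    calc |s * f (y * s)| = y⁻¹ * |y * s * f (y * s)| := by
          rw [mul_assoc y, abs_mul y, abs_of_pos hy0, inv_mul_cancel_left₀ hy0.ne']
      _ ≤ (x / 2)⁻¹ * 1 := by
          gcongr
          exact hb _ (mul_pos hy0 hs)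
      _ = _ := mul_one _
  · filter_upwards [ae_restrict_mem measurableSet_Ioi] with s (hs : 0 < s) y (hy : x / 2 < y)
    have hy0 : 0 < y := (half_pos hx).trans hy
    have h := (hd (y * s) (mul_pos hy0 hs)).comp y ((hasDerivAt_id y).mul_const s)
    exact (h.mul_const (fermi s)).congr_deriv (by ring)

lemma hasDerivAt_fermiIntegral {x : ℝ} (hx : 0 < x) :
    IntegrableOn (fun s ↦ s * fermi (x * s) * fermi s) (Ioi 0) ∧
      HasDerivAt fermiIntegral (-∫ s in Ioi 0, s * fermi (x * s) * fermi s) x := by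
  have h := hasDerivAt_integral_comp_mul_mul_fermi (F := logFermi) (f := fun s ↦ -fermi s)
    (by fun_prop) (by fun_prop) (fun s _ ↦ hasDerivAt_logFermi s) (fun s hs ↦ by
      rw [mul_neg, abs_neg, abs_of_pos (mul_pos hs (fermi_pos s))]
      exact mul_fermi_le_one hs) hx (integrableOn_logFermi_mul_fermi hx)
  simp only [mul_neg, neg_mul] at h
  rw [integral_neg] at h
  exact ⟨by simpa using h.1.neg, h.2⟩

lemma hasDerivAt_boseIntegral {x : ℝ} (hx : 0 < x) :
    IntegrableOn (fun s ↦ s * bose (x * s) * fermi s) (Ioi 0) ∧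
      HasDerivAt boseIntegral (∫ s in Ioi 0, s * bose (x * s) * fermi s) x :=
  hasDerivAt_integral_comp_mul_mul_fermi (by fun_prop) (by fun_prop)
    (fun _ ↦ hasDerivAt_logBose) (fun s hs ↦ by
      rw [abs_of_pos (mul_pos hs (bose_pos hs))]
      exact mul_bose_le_one hs) hx (integrableOn_logBose_mul_fermi hx)

lemma eq_of_hasDerivAt_eq_zero_of_pos {f : ℝ → ℝ} (h : ∀ x, 0 < x → HasDerivAt f 0 x) {x y : ℝ}
    (hx : 0 < x) (hy : 0 < y) : f x = f y :=
  isOpen_Ioi.is_const_of_deriv_eq_zero isPreconnected_Ioi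
    (fun z hz ↦ (h z hz).differentiableAt.differentiableWithinAt) (fun z hz ↦ (h z hz).deriv) hx hy

lemma integral_Ioi_mul_comp_mul_left (g : ℝ → ℝ) {c : ℝ} (hc : 0 < c) :
    ∫ s in Ioi 0, s * g s = c ^ 2 * ∫ s in Ioi 0, s * g (c * s) := by
  have h := integral_comp_mul_left_Ioi (fun s ↦ s * g s) 0 hc
  simp only [mul_zero, smul_eq_mul, mul_assoc] at h
  rw [integral_const_mul] at h
  rw [sq, mul_assoc, h, mul_inv_cancel_left₀ hc.ne']

lemma integrableOn_Ioi_mul_comp_mul_left {g : ℝ → ℝ} {c : ℝ} (hc : 0 < c)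
    (h : IntegrableOn (fun s ↦ s * g s) (Ioi 0)) :
    IntegrableOn (fun s ↦ s * g (c * s)) (Ioi 0) := by
  have h1 := (integrableOn_Ioi_comp_mul_left_iff (fun s ↦ s * g s) 0 hc).2 (by simpa using h)
  refine (h1.const_mul c⁻¹).congr (.of_forall fun s ↦ ?_)
  simp only [mul_assoc, inv_mul_cancel_left₀ hc.ne']

lemma integrableOn_mul_bose_mul_fermi {a b : ℝ} (ha : 0 < a) (hb : 0 < b) :
    IntegrableOn (fun s ↦ s * (bose (a * s) * fermi (b * s))) (Ioi 0) := by
  have h := (hasDerivAt_boseIntegral (div_pos ha hb)).1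
  simp only [mul_assoc] at h
  refine (integrableOn_Ioi_mul_comp_mul_left hb
    (g := fun s ↦ bose (a / b * s) * fermi s) h).congr
    (.of_forall fun s ↦ ?_)
  simp only [← mul_assoc, div_mul_cancel₀ a hb.ne']

lemma hasDerivAt_boseIntegral_div {a b : ℝ} (ha : 0 < a) (hb : 0 < b) :
    HasDerivAt boseIntegral
      (b ^ 2 * ∫ s in Ioi 0, s * (bose (a * s) * fermi (b * s))) (a / b) := by
  refine (hasDerivAt_boseIntegral (div_pos ha hb)).2.congr_deriv ?_
  simp only [mul_assoc]
  rw [integral_Ioi_mul_comp_mul_left (fun s ↦ bose (a / b * s) * fermi s) hb]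
  simp only [← mul_assoc, div_mul_cancel₀ a hb.ne']

lemma bose_two_mul (s : ℝ) : bose (2 * s) = bose s * fermi s := by
  have h2 : exp (2 * s) - 1 = (exp s - 1) * (exp s + 1) := by
    rw [two_mul, exp_add]; ring
  rw [fermi, bose, bose, h2, one_div_mul_one_div]

lemma integrableOn_mul_bose : IntegrableOn (fun s ↦ s * bose s) (Ioi 0) := by
  have h := integrableOn_mul_bose_mul_fermi one_pos one_pos
  have h' : IntegrableOn (fun s ↦ s * bose (2 * s)) (Ioi 0) := by
    refine h.congr_fun (fun s _ ↦ ?_) measurableSet_Ioi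
    simp only [one_mul, bose_two_mul]
  refine (integrableOn_Ioi_mul_comp_mul_left (g := fun s ↦ bose (2 * s)) one_half_pos h').congr
    (.of_forall fun s ↦ ?_)
  ring_nf

lemma integral_Ioi_mul_exp_neg_mul {r : ℝ} (hr : 0 < r) :
    ∫ s in Ioi 0, s * exp (-(r * s)) = 1 / r ^ 2 := by
  have h := integral_rpow_mul_exp_neg_mul_Ioi two_pos hr
  norm_num at h
  simpa using h

lemma integral_mul_bose : ∫ s in Ioi 0, s * bose s = π ^ 2 / 6 := by
  have hval (n : ℕ) :
      ∫ s in Ioi (0 : ℝ), s * exp (-((n + 1 : ℕ) * s)) = 1 / ((n + 1 : ℕ) : ℝ) ^ 2 :=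
    integral_Ioi_mul_exp_neg_mul (by positivity)
  have hzeta : HasSum (fun n : ℕ ↦ 1 / ((n + 1 : ℕ) : ℝ) ^ 2) (π ^ 2 / 6) := by
    simpa using (hasSum_nat_add_iff' 1).2 hasSum_zeta_two
  have hsum := hasSum_integral_of_summable_integral_norm (μ := volume.restrict (Ioi 0))
    (F := fun (n : ℕ) (s : ℝ) ↦ s * exp (-((n + 1 : ℕ) * s)))
    (fun n ↦ not_imp_comm.1 integral_undef (by rw [hval]; positivity)) (by
      refine hzeta.summable.congr fun n ↦ ?_
      rw [← hval]
      refine setIntegral_congr_fun measurableSet_Ioi fun s hs ↦ ?_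
      exact (norm_of_nonneg (mul_nonneg (le_of_lt hs) (exp_pos _).le)).symm)
  simp only [hval] at hsum
  rw [← hsum.unique hzeta]
  refine setIntegral_congr_fun measurableSet_Ioi fun s (hs : 0 < s) ↦ ?_
  have h1 : exp (-s) < 1 := exp_lt_one_iff.2 (by linarith)
  have hgeom := (hasSum_geometric_of_lt_one (exp_pos (-s)).le h1).mul_left (s * exp (-s))
  have hterm (n : ℕ) : s * exp (-((n + 1 : ℕ) * s)) = s * exp (-s) * exp (-s) ^ n := by
    rw [mul_assoc, ← pow_succ', ← exp_nat_mul, mul_neg]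
  simp only [hterm]
  rw [hgeom.tsum_eq, bose, exp_neg]
  have h2 : exp s - 1 ≠ 0 := by linarith [add_one_lt_exp hs.ne']
  field_simp

lemma integrableOn_mul_fermi : IntegrableOn (fun s ↦ s * fermi s) (Ioi 0) := by
  refine (integrableOn_mul_bose.sub ((integrableOn_Ioi_mul_comp_mul_left two_pos
    integrableOn_mul_bose).const_mul 2)).congr_fun (fun s (hs : 0 < s) ↦ ?_) measurableSet_Ioi
  simp only [Pi.sub_apply, fermi_eq_bose_sub hs]
  ring

lemma integral_mul_fermi : ∫ s in Ioi 0, s * fermi s = π ^ 2 / 12 := by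
  have h2 := integral_Ioi_mul_comp_mul_left bose two_pos
  have h : ∫ s in Ioi 0, s * fermi s = ∫ s in Ioi 0, (s * bose s - 2 * (s * bose (2 * s))) :=
    setIntegral_congr_fun measurableSet_Ioi fun s (hs : 0 < s) ↦ by
      simp only [fermi_eq_bose_sub hs]; ring
  rw [h, integral_sub integrableOn_mul_bose ((integrableOn_Ioi_mul_comp_mul_left two_pos
    integrableOn_mul_bose).const_mul 2), integral_const_mul]
  rw [integral_mul_bose] at h2 ⊢
  linarith

lemma tendsto_logFermi_atTop : Tendsto logFermi atTop (𝓝 0) :=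
  squeeze_zero logFermi_nonneg logFermi_le_exp_neg tendsto_exp_neg_atTop_nhds_zero

lemma fermiIntegral_one : fermiIntegral 1 = log 2 ^ 2 / 2 := by
  have h0 (s : ℝ) : HasDerivAt (fun s ↦ -(logFermi s) ^ 2 / 2) (logFermi (1 * s) * fermi s) s := by
    refine (((hasDerivAt_logFermi s).pow 2).neg.div_const 2).congr_deriv ?_
    rw [one_mul]
    push_cast
    ring
  have h := integral_Ioi_of_hasDerivAt_of_tendsto' (a := 0) (fun s _ ↦ h0 s)
    (integrableOn_logFermi_mul_fermi one_pos)
    (by simpa using ((tendsto_logFermi_atTop.pow 2).neg.div_const 2))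
  rw [fermiIntegral, h, logFermi]
  norm_num
  ring

lemma fermiIntegral_add_fermiIntegral_inv {x : ℝ} (hx : 0 < x) :
    fermiIntegral x + fermiIntegral x⁻¹ = log 2 ^ 2 := by
  have h (y : ℝ) (hy : 0 < y) :
      HasDerivAt (fun x ↦ fermiIntegral x + fermiIntegral x⁻¹) 0 y := by
    have h1 := (hasDerivAt_fermiIntegral hy).2
    have h2 := (hasDerivAt_fermiIntegral (inv_pos.2 hy)).2
    simp only [mul_assoc] at h1 h2
    rw [integral_Ioi_mul_comp_mul_left (fun s ↦ fermi (y⁻¹ * s) * fermi s) hy] at h2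
    simp only [inv_mul_cancel_left₀ hy.ne'] at h2
    refine (h1.add (h2.comp y (hasDerivAt_inv hy.ne'))).congr_deriv ?_
    simp only [fun s ↦ mul_comm (fermi s) (fermi (y * s))]
    generalize ∫ s in Ioi 0, s * (fermi (y * s) * fermi s) = I
    field_simp
    ring
  rw [eq_of_hasDerivAt_eq_zero_of_pos h hx one_pos, inv_one, fermiIntegral_one]
  ring

lemma tendsto_mul_bose_nhdsGT_zero : Tendsto (fun s ↦ s * bose s) (𝓝[>] 0) (𝓝 1) := by
  have h := (hasDerivAt_exp 0).tendsto_slope_zero_right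
  simp only [zero_add, exp_zero, smul_eq_mul] at h
  simpa [bose, mul_comm] using h.inv₀ one_ne_zero

lemma tendsto_mul_bose_atTop : Tendsto (fun s ↦ s * bose s) atTop (𝓝 0) := by
  have hlim : Tendsto (fun s : ℝ ↦ 2 * exp (-(s / 2))) atTop (𝓝 0) := by
    simpa using (tendsto_exp_neg_atTop_nhds_zero.comp
      (tendsto_id.atTop_div_const (two_pos (α := ℝ)))).const_mul 2
  refine squeeze_zero' ?_ ?_ hlim
  · filter_upwards [eventually_gt_atTop 0] with s hs using (mul_pos hs (bose_pos hs)).le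
  · filter_upwards [eventually_gt_atTop 0] with s hs
    have h1 := mul_bose_le_one (half_pos hs)
    calc s * bose s = 2 * (s / 2 * bose (s / 2) * fermi (s / 2)) := by
          rw [mul_assoc (s / 2), ← bose_two_mul]
          ring_nf
      _ ≤ 2 * (1 * exp (-(s / 2))) := by
          gcongr
          · exact (fermi_pos _).le
          · exact fermi_le_exp_neg _
      _ = _ := by rw [one_mul]

lemma integral_bose_mul_fermi_add {y : ℝ} (hy : 0 < y) :
    (∫ s in Ioi 0, s * (bose (y * s) * fermi s))
      + 2 * ∫ s in Ioi 0, s * (bose (2 * s) * fermi (y * s)) = log 2 / y := by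
  have hi1 : IntegrableOn (fun s ↦ s * (bose (y * s) * fermi s)) (Ioi 0) := by
    simpa using integrableOn_mul_bose_mul_fermi hy one_pos
  have hi2 := (integrableOn_mul_bose_mul_fermi two_pos hy).const_mul 2
  set f : ℝ → ℝ := fun s ↦ s * bose s * (y * s * bose (y * s)) / y with hf
  have hyid : Tendsto (fun s ↦ y * s) (𝓝[>] 0) (𝓝[>] 0) :=
    tendsto_nhdsWithin_iff.2 ⟨by
      simpa using ((continuous_const_mul y).tendsto 0).mono_left nhdsWithin_le_nhds,
      eventually_nhdsWithin_of_forall fun s hs ↦ mul_pos hy hs⟩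
  have hL : Tendsto f (𝓝[>] 0) (𝓝 (1 / y)) := by
    simpa using (tendsto_mul_bose_nhdsGT_zero.mul
      (tendsto_mul_bose_nhdsGT_zero.comp hyid)).div_const y
  have hR : Tendsto f atTop (𝓝 0) := by
    simpa using (tendsto_mul_bose_atTop.mul
      (tendsto_mul_bose_atTop.comp (tendsto_id.const_mul_atTop hy))).div_const y
  have hcont : ContinuousOn bose (Ioi 0) := by
    unfold bose
    exact continuousOn_const.div (by fun_prop) fun s (hs : 0 < s) ↦ by
      linarith [add_one_lt_exp hs.ne']
  have hloc : LocallyIntegrableOn f (Ioi 0) := by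
    refine ContinuousOn.locallyIntegrableOn ?_ measurableSet_Ioi
    have hcont' : ContinuousOn (fun s ↦ bose (y * s)) (Ioi 0) :=
      hcont.comp (by fun_prop) fun s (hs : 0 < s) ↦ mul_pos hy hs
    fun_prop
  have hpt (s : ℝ) (hs : s ∈ Ioi 0) : s * (bose (y * s) * fermi s)
      + 2 * (s * (bose (2 * s) * fermi (y * s))) = s⁻¹ • (f (1 * s) - f (2 * s)) := by
    have hs' : (0 : ℝ) < s := hs
    rw [fermi_eq_bose_sub hs, fermi_eq_bose_sub (mul_pos hy hs)]
    simp only [hf, smul_eq_mul, one_mul, mul_left_comm y 2 s]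
    field_simp
    ring
  have h := Frullani.integral_Ioi_eq hloc one_pos two_pos hL hR
    ((hi1.add hi2).congr_fun hpt measurableSet_Ioi)
  rw [← setIntegral_congr_fun measurableSet_Ioi hpt, integral_add hi1 hi2, integral_const_mul] at h
  rw [h]
  simp [div_eq_mul_inv]

lemma boseIntegral_sub_boseIntegral_two_div {y : ℝ} (hy : 0 < y) :
    boseIntegral y - boseIntegral (2 / y) = log 2 * (log y - log 2 / 2) := by
  have h (x : ℝ) (hx : 0 < x) :
      HasDerivAt (fun y ↦ boseIntegral y - boseIntegral (2 / y) - log 2 * log y) 0 x := by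
    have h1 := (hasDerivAt_boseIntegral hx).2
    have h2 := (hasDerivAt_boseIntegral_div two_pos hx).comp x
      ((hasDerivAt_inv hx.ne').const_mul 2)
    simp only [mul_assoc] at h1
    refine ((h1.sub h2).sub ((hasDerivAt_log hx.ne').const_mul (log 2))).congr_deriv ?_
    have h3 := integral_bose_mul_fermi_add hx
    rw [← div_eq_mul_inv, ← h3]
    generalize ∫ s in Ioi 0, s * (bose (x * s) * fermi s) = I₁
    generalize ∫ s in Ioi 0, s * (bose (2 * s) * fermi (x * s)) = I₂
    field_simp
    ring
  have hc := eq_of_hasDerivAt_eq_zero_of_pos h hy (sqrt_pos.2 two_pos)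
  rw [div_sqrt, sub_self, log_sqrt two_pos.le] at hc
  linarith

lemma tendsto_fermiIntegral_atTop : Tendsto fermiIntegral atTop (𝓝 0) := by
  refine squeeze_zero' (.of_forall fun x ↦ integral_nonneg fun s ↦
    mul_nonneg (logFermi_nonneg _) (fermi_pos s).le) ?_ tendsto_inv_atTop_zero
  filter_upwards [eventually_gt_atTop 0] with x hx
  have hval : ∫ s in Ioi 0, exp (-x * s) = x⁻¹ := by
    rw [integral_exp_mul_Ioi (by linarith)]
    simp
  rw [← hval, fermiIntegral]
  refine setIntegral_mono_on (integrableOn_logFermi_mul_fermi hx) (exp_neg_integrableOn_Ioi 0 hx)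
    measurableSet_Ioi fun s (hs : 0 < s) ↦ ?_
  rw [neg_mul, ← mul_one (exp _)]
  refine mul_le_mul (logFermi_le_exp_neg _) ((fermi_le_exp_neg s).trans ?_) (fermi_pos s).le
    (exp_pos _).le
  exact exp_le_one_iff.2 (by linarith)

lemma integral_four_term {x : ℝ} (hx : 0 < x) :
    -(∫ s in Ioi 0, s * (fermi (x * s) * fermi s))
      + (∫ s in Ioi 0, s * (fermi ((x + 2) * s) * fermi s))
      - (∫ s in Ioi 0, s * (bose ((x + 1) * s) * fermi (x * s)))
      - (∫ s in Ioi 0, s * (bose ((x + 1) * s) * fermi ((x + 2) * s)))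
      = π ^ 2 / 12 / (x + 2) ^ 2 - π ^ 2 / 6 / (x + 1) ^ 2 := by
  have hx1 : 0 < x + 1 := by linarith
  have hx2 : 0 < x + 2 := by linarith
  have hi1 := (hasDerivAt_fermiIntegral hx).1
  have hi2 := (hasDerivAt_fermiIntegral hx2).1
  have hi3 := integrableOn_mul_bose_mul_fermi hx1 hx
  have hi4 := integrableOn_mul_bose_mul_fermi hx1 hx2
  simp only [mul_assoc] at hi1 hi2
  have hf := integral_Ioi_mul_comp_mul_left fermi hx2
  have hb := integral_Ioi_mul_comp_mul_left bose hx1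
  rw [integral_mul_fermi] at hf
  rw [integral_mul_bose] at hb
  have hpt (s : ℝ) (hs : s ∈ Ioi 0) :
      -(s * (fermi (x * s) * fermi s)) + s * (fermi ((x + 2) * s) * fermi s)
        - s * (bose ((x + 1) * s) * fermi (x * s)) - s * (bose ((x + 1) * s) * fermi ((x + 2) * s))
        = s * fermi ((x + 2) * s) - s * bose ((x + 1) * s) := by
    have hpos : 0 < (x + 1) * s := mul_pos hx1 hs
    have e1 : x * s + s = (x + 1) * s := by ring
    have e2 : (x + 2) * s + -s = (x + 1) * s := by ring
    have h1 := fermi_mul_fermi (a := x * s) (b := s) (by rwa [e1])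
    have h2 := fermi_mul_fermi (a := (x + 2) * s) (b := -s) (by rwa [e2])
    rw [e1] at h1
    rw [e2, fermi_neg] at h2
    linear_combination -s * h1 - s * h2
  have h := setIntegral_congr_fun (μ := volume) measurableSet_Ioi hpt
  rw [integral_sub _ hi4, integral_sub _ hi3, integral_add _ hi2, integral_neg,
    integral_sub (integrableOn_Ioi_mul_comp_mul_left hx2 integrableOn_mul_fermi)
      (integrableOn_Ioi_mul_comp_mul_left hx1 integrableOn_mul_bose)] at h
  · rw [h, hf, hb, mul_div_cancel_left₀ _ (by positivity), mul_div_cancel_left₀ _ (by positivity)]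
  · exact hi1.neg
  · exact hi1.neg.add hi2
  · exact (hi1.neg.add hi2).sub hi3

lemma fermiIntegral_sub_fermiIntegral_add_two {x : ℝ} (hx : 0 < x) :
    fermiIntegral x - fermiIntegral (x + 2) + boseIntegral ((x + 1) / x)
      - boseIntegral ((x + 1) / (x + 2)) = π ^ 2 / 6 / (x + 1) - π ^ 2 / 12 / (x + 2) := by
  set E : ℝ → ℝ := fun x ↦ fermiIntegral x - fermiIntegral (x + 2) + boseIntegral ((x + 1) / x)
    - boseIntegral ((x + 1) / (x + 2)) - (π ^ 2 / 6 / (x + 1) - π ^ 2 / 12 / (x + 2))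
  have hderiv (x : ℝ) (hx : 0 < x) : HasDerivAt E 0 x := by
    have hx1 : 0 < x + 1 := by linarith
    have hx2 : 0 < x + 2 := by linarith
    have hd0 := hasDerivAt_id' x
    have hd1 := hd0.add_const 1
    have hd2 := hd0.add_const 2
    have h1 := (hasDerivAt_fermiIntegral hx).2
    have h2 := (hasDerivAt_fermiIntegral hx2).2.comp x hd2
    have h3 := HasDerivAt.comp (h := fun y ↦ (y + 1) / y) x (hasDerivAt_boseIntegral_div hx1 hx)
      (hd1.fun_div hd0 hx.ne')
    have h4 := HasDerivAt.comp (h := fun y ↦ (y + 1) / (y + 2)) x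
      (hasDerivAt_boseIntegral_div hx1 hx2) (hd1.fun_div hd2 hx2.ne')
    have h5 := (hasDerivAt_const x (π ^ 2 / 6)).fun_div hd1 hx1.ne'
    have h6 := (hasDerivAt_const x (π ^ 2 / 12)).fun_div hd2 hx2.ne'
    simp only [mul_assoc] at h1 h2
    refine ((((h1.sub h2).add h3).sub h4).sub (h5.sub h6)).congr_deriv ?_
    rw [zero_mul, zero_mul, zero_sub, zero_sub, mul_one, mul_one, neg_div, neg_div]
    have h := integral_four_term hx
    generalize ∫ s in Ioi 0, s * (fermi (x * s) * fermi s) = I₁ at h ⊢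
    generalize ∫ s in Ioi 0, s * (fermi ((x + 2) * s) * fermi s) = I₂ at h ⊢
    generalize ∫ s in Ioi 0, s * (bose ((x + 1) * s) * fermi (x * s)) = I₃ at h ⊢
    generalize ∫ s in Ioi 0, s * (bose ((x + 1) * s) * fermi ((x + 2) * s)) = I₄ at h ⊢
    have h3' : x ^ 2 * I₃ * ((1 * x - (x + 1) * 1) / x ^ 2) = -I₃ := by field_simp; ring
    have h4' : (x + 2) ^ 2 * I₄ * ((1 * (x + 2) - (x + 1) * 1) / (x + 2) ^ 2) = I₄ := by
      field_simp; ring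
    linear_combination h + h3' - h4'
  have hlim : Tendsto E atTop (𝓝 0) := by
    have hinv (c : ℝ) : Tendsto (fun x : ℝ ↦ (x + c)⁻¹) atTop (𝓝 0) :=
      tendsto_inv_atTop_zero.comp (tendsto_atTop_add_const_right _ c tendsto_id)
    have hB : Tendsto boseIntegral (𝓝 1) (𝓝 (boseIntegral 1)) :=
      (hasDerivAt_boseIntegral one_pos).2.continuousAt
    have hr1 : Tendsto (fun x : ℝ ↦ (x + 1) / x) atTop (𝓝 1) := by
      have h := (hinv 0).const_add 1
      rw [add_zero] at h
      refine h.congr' ?_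
      filter_upwards [eventually_gt_atTop 0] with x hx
      field_simp
      ring
    have hr2 : Tendsto (fun x : ℝ ↦ (x + 1) / (x + 2)) atTop (𝓝 1) := by
      have h := (hinv 2).const_sub 1
      rw [sub_zero] at h
      refine h.congr' ?_
      filter_upwards [eventually_gt_atTop 0] with x hx
      field_simp
      ring
    have h := (((tendsto_fermiIntegral_atTop.sub
      (tendsto_fermiIntegral_atTop.comp (tendsto_atTop_add_const_right _ 2 tendsto_id))).add
      (hB.comp hr1)).sub (hB.comp hr2)).sub
      (((hinv 1).const_mul (π ^ 2 / 6)).sub ((hinv 2).const_mul (π ^ 2 / 12)))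
    rw [sub_self, zero_add, sub_self, mul_zero, mul_zero, sub_self, sub_self] at h
    exact h
  have hzero : E x = 0 := by
    refine tendsto_nhds_unique (tendsto_const_nhds.congr' ?_) hlim
    filter_upwards [eventually_gt_atTop 0] with y hy
    exact eq_of_hasDerivAt_eq_zero_of_pos hderiv hx hy
  exact sub_eq_zero.1 hzero

lemma Jfun_eq_fermiIntegral (x : ℝ) : Jfun x = fermiIntegral x := by
  have himage : (fun s : ℝ ↦ exp (-s)) '' Ioi 0 = Ioo 0 1 := by
    ext t
    constructor
    · rintro ⟨s, hs, rfl⟩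
      exact ⟨exp_pos _, exp_lt_one_iff.2 (neg_lt_zero.2 hs)⟩
    · rintro ⟨h0, h1⟩
      exact ⟨-log t, neg_pos.2 (log_neg h0 h1), by simp [exp_log h0]⟩
  rw [Jfun, intervalIntegral.integral_of_le zero_le_one, integral_Ioc_eq_integral_Ioo, ← himage,
    integral_image_eq_integral_abs_deriv_smul measurableSet_Ioi
      (fun s _ ↦ (hasDerivAt_neg s).exp.hasDerivWithinAt)
      (fun a _ b _ h ↦ neg_injective (exp_injective h))]
  refine setIntegral_congr_fun measurableSet_Ioi fun s _ ↦ ?_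
  have h : exp (-s) ^ x = exp (-(x * s)) := by rw [← exp_mul]; ring_nf
  simp only [h, mul_neg, mul_one, abs_neg, abs_exp, smul_eq_mul, logFermi, fermi]
  rw [exp_neg s]
  field_simp

theorem J_one_add_sqrt_two :
    Jfun (1 + Real.sqrt 2) =
      -(Real.pi ^ 2 / 24) + Real.log 2 ^ 2 / 2
        + Real.log 2 * Real.log (1 + Real.sqrt 2) / 2 := by
  have hsq : √2 ^ 2 = 2 := sq_sqrt two_pos.le
  have hlt : 1 < √2 := by nlinarith [sqrt_nonneg 2]
  have hx : 0 < √2 - 1 := by linarith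
  have hpos : 0 < 1 + √2 := by linarith
  have hinv : (1 + √2)⁻¹ = √2 - 1 := inv_eq_of_mul_eq_one_right (by nlinarith)
  have h1 := fermiIntegral_add_fermiIntegral_inv hpos
  have h2 := fermiIntegral_sub_fermiIntegral_add_two hx
  have h3 := boseIntegral_sub_boseIntegral_two_div (mul_pos (sqrt_pos.2 two_pos) hpos)
  have e1 : (√2 - 1 + 1) / (√2 - 1) = √2 * (1 + √2) := by
    rw [div_eq_iff hx.ne']; nlinarith
  have e2 : (√2 - 1 + 1) / (√2 - 1 + 2) = 2 / (√2 * (1 + √2)) := by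
    rw [div_eq_div_iff (by linarith) (by positivity)]; nlinarith
  have e3 : √2 - 1 + 2 = 1 + √2 := by ring
  have e4 : π ^ 2 / 6 / (√2 - 1 + 1) - π ^ 2 / 12 / (√2 - 1 + 2) = π ^ 2 / 12 := by
    rw [e3, div_eq_mul_inv _ (1 + √2), hinv, sub_add_cancel]
    field_simp
    linear_combination (-6 : ℝ) * hsq
  rw [e1, e2, e4, e3] at h2
  rw [hinv] at h1
  rw [log_mul (sqrt_pos.2 two_pos).ne' hpos.ne', log_sqrt two_pos.le] at h3
  rw [Jfun_eq_fermiIntegral]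
  linear_combination (1 / 2 : ℝ) * h1 - (1 / 2 : ℝ) * h2 + (1 / 2 : ℝ) * h3
end

section
/- J(4+√17) = −π²/6 + (log 2)²/2 + log 2 · log(4+√17). -/
open Real MeasureTheory

open Set

lemma rpow_mem_Ioo {p t : ℝ} (hp : 0 < p) (ht : t ∈ Ioo (0 : ℝ) 1) : t ^ p ∈ Ioo (0 : ℝ) 1 :=
  ⟨rpow_pos_of_pos ht.1 p, rpow_lt_one ht.1.le ht.2 hp⟩

lemma image_rpow_Ioo {p : ℝ} (hp : 0 < p) :
    (fun t : ℝ => t ^ p) '' Ioo 0 1 = Ioo 0 1 := by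
  ext s
  constructor
  · rintro ⟨t, ht, rfl⟩
    exact rpow_mem_Ioo hp ht
  · intro hs
    exact ⟨s ^ p⁻¹, rpow_mem_Ioo (inv_pos.2 hp) hs, rpow_inv_rpow hs.1.le hp.ne'⟩

lemma injOn_rpow_Ioo {p : ℝ} (hp : 0 < p) : InjOn (fun t : ℝ => t ^ p) (Ioo 0 1) :=
  fun _ ha _ hb h => (rpow_left_inj ha.1.le hb.1.le hp.ne').1 h

lemma hasDerivWithinAt_rpow_Ioo (p : ℝ) : ∀ t ∈ Ioo (0 : ℝ) 1,
    HasDerivWithinAt (fun t : ℝ => t ^ p) (p * t ^ (p - 1)) (Ioo 0 1) t :=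
  fun _ ht => (hasDerivAt_rpow_const (Or.inl ht.1.ne')).hasDerivWithinAt

lemma IntervalIntegrable.comp_rpow_zero_one {f g : ℝ → ℝ} {p : ℝ} (hp : 0 < p)
    (hf : IntervalIntegrable f volume 0 1)
    (hg : ∀ t ∈ Ioo (0 : ℝ) 1, g t = p * t ^ (p - 1) * f (t ^ p)) :
    IntervalIntegrable g volume 0 1 := by
  rw [intervalIntegrable_iff_integrableOn_Ioo_of_le zero_le_one] at hf ⊢
  rw [← image_rpow_Ioo hp, integrableOn_image_iff_integrableOn_abs_deriv_smul measurableSet_Ioo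
    (hasDerivWithinAt_rpow_Ioo p) (injOn_rpow_Ioo hp)] at hf
  refine hf.congr_fun (fun t ht => ?_) measurableSet_Ioo
  have := rpow_pos_of_pos ht.1 (p - 1)
  simp [hg t ht, abs_of_pos hp, abs_of_pos this]

lemma integral_comp_rpow_zero_one {f g : ℝ → ℝ} {p : ℝ} (hp : 0 < p)
    (hg : ∀ t ∈ Ioo (0 : ℝ) 1, g t = p * t ^ (p - 1) * f (t ^ p)) :
    ∫ t in (0 : ℝ)..1, g t = ∫ s in (0 : ℝ)..1, f s := by
  rw [intervalIntegral.integral_of_le zero_le_one, intervalIntegral.integral_of_le zero_le_one,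
    integral_Ioc_eq_integral_Ioo, integral_Ioc_eq_integral_Ioo]
  conv_rhs => rw [← image_rpow_Ioo hp]
  rw [integral_image_eq_integral_abs_deriv_smul measurableSet_Ioo
    (hasDerivWithinAt_rpow_Ioo p) (injOn_rpow_Ioo hp)]
  refine setIntegral_congr_fun measurableSet_Ioo (fun t ht => ?_)
  have := rpow_pos_of_pos ht.1 (p - 1)
  simp [hg t ht, abs_of_pos hp, abs_of_pos this]

lemma continuousOn_dslope_Icc {f : ℝ → ℝ} (hf : ContinuousOn f (Icc 0 1))
    (hd : DifferentiableAt ℝ f 1) : ContinuousOn (dslope f 1) (Icc 0 1) := by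
  intro t ht
  rcases eq_or_ne t 1 with rfl | h
  · exact (continuousAt_dslope_same.2 hd).continuousWithinAt
  · exact (continuousWithinAt_dslope_of_ne h).2 (hf t ht)

lemma intervalIntegrable_log_div_sub_one :
    IntervalIntegrable (fun s : ℝ => log s / (s - 1)) volume 0 1 := by
  have hd : ContinuousOn (dslope (fun s : ℝ => s * log s) 1) (Icc 0 1) := by
    refine continuousOn_dslope_Icc continuous_mul_log.continuousOn ?_
    exact (hasDerivAt_mul_log one_ne_zero).differentiableAt
  rw [← uIcc_of_le zero_le_one] at hd
  refine (hd.intervalIntegrable.sub intervalIntegral.intervalIntegrable_log').congr_uIoo ?_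
  intro s hs
  rw [uIoo_of_le zero_le_one] at hs
  have h1 : s - 1 ≠ 0 := by linarith [hs.2]
  simp only [dslope_of_ne _ hs.2.ne, slope_def_field, log_one]
  field_simp
  ring

lemma integral_pow_mul_log_zero_one (n : ℕ) :
    ∫ s in (0 : ℝ)..1, s ^ n * log s = -(1 / ((n + 1 : ℕ) : ℝ) ^ 2) := by
  have hn : ((n : ℝ) + 1) ≠ 0 := by positivity
  have hc : Continuous fun s : ℝ => s ^ n * (s * log s) / (n + 1) - s ^ (n + 1) / (n + 1) ^ 2 := by
    have := continuous_mul_log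
    fun_prop
  rw [intervalIntegral.integral_eq_sub_of_hasDerivAt_of_le zero_le_one hc.continuousOn]
  · simp
  · intro s hs
    have h0 : s ≠ 0 := hs.1.ne'
    have h := (((hasDerivAt_pow (n + 1) s).mul (hasDerivAt_log h0)).div_const ((n : ℝ) + 1)).sub
      ((hasDerivAt_pow (n + 1) s).div_const (((n : ℝ) + 1) ^ 2))
    convert h using 1
    · ext x
      simp only [Pi.sub_apply, Pi.mul_apply]
      ring
    · simp only [Nat.add_sub_cancel]
      push_cast
      field_simp
      ring
  · exact intervalIntegral.intervalIntegrable_log'.continuousOn_mul (by fun_prop)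

lemma integral_log_div_sub_one : ∫ s in (0 : ℝ)..1, log s / (s - 1) = π ^ 2 / 6 := by
  have hI (n : ℕ) : IntervalIntegrable (fun s : ℝ => s ^ n * log s) volume 0 1 :=
    intervalIntegral.intervalIntegrable_log'.continuousOn_mul (by fun_prop)
  have hz : HasSum (fun n : ℕ => 1 / ((n + 1 : ℕ) : ℝ) ^ 2) (π ^ 2 / 6) := by
    simpa using (hasSum_nat_add_iff' 1).2 hasSum_zeta_two
  have hval (n : ℕ) : ∫ s in Ioo (0 : ℝ) 1, -(s ^ n * log s) = 1 / ((n + 1 : ℕ) : ℝ) ^ 2 := by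
    rw [← integral_Ioc_eq_integral_Ioo, ← intervalIntegral.integral_of_le zero_le_one,
      intervalIntegral.integral_neg, integral_pow_mul_log_zero_one, neg_neg]
  have hnorm (n : ℕ) : ∫ s in Ioo (0 : ℝ) 1, ‖-(s ^ n * log s)‖ = 1 / ((n + 1 : ℕ) : ℝ) ^ 2 := by
    rw [← hval]
    refine setIntegral_congr_fun measurableSet_Ioo fun s hs => norm_of_nonneg ?_
    have := mul_nonneg (pow_pos hs.1 n).le (neg_nonneg.2 (log_nonpos hs.1.le hs.2.le))
    linarith
  have hsum := hasSum_integral_of_summable_integral_norm (μ := volume.restrict (Ioo (0 : ℝ) 1))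
    (F := fun (n : ℕ) (s : ℝ) => -(s ^ n * log s))
    (fun n => ((intervalIntegrable_iff_integrableOn_Ioo_of_le zero_le_one).1 (hI n)).neg)
    (by simpa only [hnorm] using hz.summable)
  simp only [hval] at hsum
  rw [hz.unique hsum, intervalIntegral.integral_of_le zero_le_one, integral_Ioc_eq_integral_Ioo]
  refine setIntegral_congr_fun measurableSet_Ioo fun s hs => ?_
  have h := ((hasSum_geometric_of_lt_one hs.1.le hs.2).mul_right (-log s)).tsum_eq
  have h1 : s - 1 ≠ 0 := by linarith [hs.2]
  have h2 : 1 - s ≠ 0 := by linarith [hs.2]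
  simp only [mul_neg] at h
  simp only [h]
  field_simp
  ring

lemma one_sub_rpow_pos {p t : ℝ} (hp : 0 < p) (ht : t ∈ Ico (0 : ℝ) 1) : 0 < 1 - t ^ p :=
  sub_pos.2 (rpow_lt_one ht.1 ht.2 hp)

lemma one_add_rpow_pos {p t : ℝ} (ht : 0 ≤ t) : 0 < 1 + t ^ p := by
  have := rpow_nonneg ht p
  linarith

/-- The quotient `(1 - t ^ p) / (1 - t)`, extended by `p` at `t = 1`. -/
noncomputable def rpowQuot (p : ℝ) : ℝ → ℝ := dslope (fun t : ℝ => t ^ p) 1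

lemma rpowQuot_one (p : ℝ) : rpowQuot p 1 = p := by
  rw [rpowQuot, dslope_same, (hasDerivAt_rpow_const (Or.inl one_ne_zero)).deriv]
  simp

lemma rpowQuot_of_ne (p : ℝ) {t : ℝ} (ht : t ≠ 1) : rpowQuot p t = (1 - t ^ p) / (1 - t) := by
  rw [rpowQuot, dslope_of_ne _ ht, slope_def_field, one_rpow, ← neg_div_neg_eq, neg_sub, neg_sub]

lemma rpowQuot_pos {p t : ℝ} (hp : 0 < p) (ht : t ∈ Icc (0 : ℝ) 1) : 0 < rpowQuot p t := by
  rcases eq_or_lt_of_le ht.2 with rfl | h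
  · rwa [rpowQuot_one]
  · rw [rpowQuot_of_ne p h.ne]
    exact div_pos (one_sub_rpow_pos hp ⟨ht.1, h⟩) (sub_pos.2 h)

lemma continuousOn_rpowQuot {p : ℝ} (hp : 0 < p) : ContinuousOn (rpowQuot p) (Icc 0 1) :=
  continuousOn_dslope_Icc (continuous_rpow_const hp.le).continuousOn
    (hasDerivAt_rpow_const (Or.inl one_ne_zero)).differentiableAt

lemma continuousOn_log_rpowQuot {p : ℝ} (hp : 0 < p) :
    ContinuousOn (fun t => log (rpowQuot p t)) (Icc 0 1) :=
  (continuousOn_rpowQuot hp).log fun _ ht => (rpowQuot_pos hp ht).ne'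

lemma differentiableAt_rpowQuot (p : ℝ) : DifferentiableAt ℝ (rpowQuot p) 1 := by
  have h : AnalyticAt ℝ (fun t : ℝ => t ^ p) 1 :=
    (contDiffAt_rpow_const_of_ne one_ne_zero).analyticAt
  obtain ⟨s, hs⟩ := h
  exact (HasFPowerSeriesAt.has_fpower_series_dslope_fslope hs).analyticAt.differentiableAt

lemma log_rpowQuot {p t : ℝ} (hp : 0 < p) (ht : t ∈ Ico (0 : ℝ) 1) :
    log (rpowQuot p t) = log (1 - t ^ p) - log (1 - t) := by
  rw [rpowQuot_of_ne p ht.2.ne, log_div (one_sub_rpow_pos hp ht).ne' (sub_pos.2 ht.2).ne']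

lemma intervalIntegrable_log_one_sub_rpow {p : ℝ} (hp : 0 < p) :
    IntervalIntegrable (fun t : ℝ => log (1 - t ^ p)) volume 0 1 := by
  have h1 : IntervalIntegrable (fun t : ℝ => log (1 - t)) volume 0 1 := by
    simpa using (intervalIntegral.intervalIntegrable_log' (a := 1) (b := 0)).comp_sub_left 1
  have h2 := continuousOn_log_rpowQuot hp
  rw [← uIcc_of_le zero_le_one] at h2
  refine (h1.add h2.intervalIntegrable).congr_uIoo fun t ht => ?_
  rw [uIoo_of_le zero_le_one] at ht
  simp [log_rpowQuot hp (Ioo_subset_Ico_self ht)]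

lemma IntervalIntegrable.div_one_add {f : ℝ → ℝ} (hf : IntervalIntegrable f volume 0 1) :
    IntervalIntegrable (fun t => f t / (1 + t)) volume 0 1 := by
  simp only [div_eq_mul_inv]
  refine hf.mul_continuousOn (ContinuousOn.inv₀ (by fun_prop) fun t ht => ?_)
  rw [uIcc_of_le zero_le_one] at ht
  linarith [ht.1]

lemma continuousOn_log_one_add_rpow {p : ℝ} (hp : 0 < p) :
    ContinuousOn (fun t : ℝ => log (1 + t ^ p)) (Icc 0 1) := by
  have := continuous_rpow_const hp.le
  exact ContinuousOn.log (by fun_prop) fun t ht => (one_add_rpow_pos ht.1).ne'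

lemma continuousOn_log_one_add : ContinuousOn (fun t : ℝ => log (1 + t)) (Icc 0 1) :=
  ContinuousOn.log (by fun_prop) fun t ht => by linarith [ht.1]

lemma intervalIntegrable_log_one_add_rpow {p : ℝ} (hp : 0 < p) :
    IntervalIntegrable (fun t : ℝ => log (1 + t ^ p)) volume 0 1 := by
  have h := continuousOn_log_one_add_rpow hp
  rw [← uIcc_of_le zero_le_one] at h
  exact h.intervalIntegrable

lemma continuousOn_mul_log_one_sub_rpow {g : ℝ → ℝ} {p : ℝ} (hp : 0 < p)
    (hg : ContinuousOn g (Icc 0 1)) (hd : DifferentiableAt ℝ g 1) (h1 : g 1 = 0) :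
    ContinuousOn (fun t => g t * log (1 - t ^ p)) (Icc 0 1) := by
  have hm : ContinuousOn (fun t : ℝ => (1 - t) * log (1 - t)) (Icc 0 1) :=
    (continuous_mul_log.comp (continuous_const.sub continuous_id)).continuousOn
  refine (((continuousOn_dslope_Icc hg hd).neg.mul hm).add
    (hg.mul (continuousOn_log_rpowQuot hp))).congr fun t ht => ?_
  rcases eq_or_lt_of_le ht.2 with rfl | h
  · simp [h1]
  · have h2 : t - 1 ≠ 0 := by linarith
    change g t * log (1 - t ^ p) =
      -dslope g 1 t * ((1 - t) * log (1 - t)) + g t * log (rpowQuot p t)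
    rw [dslope_of_ne _ h.ne, slope_def_field, h1, log_rpowQuot hp ⟨ht.1, h⟩]
    field_simp
    ring

lemma intervalIntegrable_log_div_one_add :
    IntervalIntegrable (fun t : ℝ => log t / (1 + t)) volume 0 1 :=
  intervalIntegral.intervalIntegrable_log'.div_one_add

lemma integral_log_div_one_add : ∫ t in (0 : ℝ)..1, log t / (1 + t) = -(π ^ 2 / 12) := by
  have h := integral_comp_rpow_zero_one (p := 2) two_pos
    (f := fun s => 2⁻¹ * (log s / (s - 1))) (g := fun t => log t / (t - 1) + log t / (1 + t))
    (fun t ht => by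
      have h1 : t - 1 ≠ 0 := by linarith [ht.2]
      have h2 : 1 + t ≠ 0 := by linarith [ht.1]
      have h3 : t ^ 2 - 1 ≠ 0 := by
        rw [show t ^ 2 - 1 = (t - 1) * (1 + t) by ring]
        exact mul_ne_zero h1 h2
      norm_num [log_pow]
      field_simp
      ring)
  rw [intervalIntegral.integral_add intervalIntegrable_log_div_sub_one
    intervalIntegrable_log_div_one_add, intervalIntegral.integral_const_mul,
    integral_log_div_sub_one] at h
  linarith

lemma log_mul_dlog_one_add_rpow {p : ℝ} (hp : 0 < p) :
    IntervalIntegrable (fun t : ℝ => log t * (p * t ^ (p - 1) / (1 + t ^ p))) volume 0 1 ∧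
      ∫ t in (0 : ℝ)..1, log t * (p * t ^ (p - 1) / (1 + t ^ p)) = -(π ^ 2 / 12) / p := by
  have h : ∀ t ∈ Ioo (0 : ℝ) 1, log t * (p * t ^ (p - 1) / (1 + t ^ p)) =
      p * t ^ (p - 1) * (fun s => p⁻¹ * (log s / (1 + s))) (t ^ p) := fun t ht => by
    simp only [log_rpow ht.1]
    field_simp
  refine ⟨(intervalIntegrable_log_div_one_add.const_mul p⁻¹).comp_rpow_zero_one hp h, ?_⟩
  rw [integral_comp_rpow_zero_one (f := fun s => p⁻¹ * (log s / (1 + s))) hp h,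
    intervalIntegral.integral_const_mul, integral_log_div_one_add]
  ring

lemma log_mul_dlog_one_sub_rpow {p : ℝ} (hp : 0 < p) :
    IntervalIntegrable (fun t : ℝ => log t * (-(p * t ^ (p - 1)) / (1 - t ^ p))) volume 0 1 ∧
      ∫ t in (0 : ℝ)..1, log t * (-(p * t ^ (p - 1)) / (1 - t ^ p)) = π ^ 2 / 6 / p := by
  have h : ∀ t ∈ Ioo (0 : ℝ) 1, log t * (-(p * t ^ (p - 1)) / (1 - t ^ p)) =
      p * t ^ (p - 1) * (fun s => p⁻¹ * (log s / (s - 1))) (t ^ p) := fun t ht => by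
    have h1 := (one_sub_rpow_pos hp (Ioo_subset_Ico_self ht)).ne'
    have h2 : t ^ p - 1 ≠ 0 := fun h => h1 (by linarith)
    simp only [log_rpow ht.1]
    field_simp
    ring
  refine ⟨(intervalIntegrable_log_div_sub_one.const_mul p⁻¹).comp_rpow_zero_one hp h, ?_⟩
  rw [integral_comp_rpow_zero_one (f := fun s => p⁻¹ * (log s / (s - 1))) hp h,
    intervalIntegral.integral_const_mul, integral_log_div_sub_one]
  ring

lemma mul_dlog_one_add_rpow {f : ℝ → ℝ} {g : ℝ → ℝ} {p : ℝ} (hp : 0 < p)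
    (hg : IntervalIntegrable g volume 0 1) (h : ∀ t ∈ Ioo (0 : ℝ) 1, f t = g (t ^ p)) :
    IntervalIntegrable (fun t : ℝ => f t * (p * t ^ (p - 1) / (1 + t ^ p))) volume 0 1 ∧
      ∫ t in (0 : ℝ)..1, f t * (p * t ^ (p - 1) / (1 + t ^ p)) =
        ∫ s in (0 : ℝ)..1, g s / (1 + s) := by
  have h : ∀ t ∈ Ioo (0 : ℝ) 1, f t * (p * t ^ (p - 1) / (1 + t ^ p)) =
      p * t ^ (p - 1) * (fun s => g s / (1 + s)) (t ^ p) := fun t ht => by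
    rw [h t ht]
    ring
  exact ⟨hg.div_one_add.comp_rpow_zero_one hp h, integral_comp_rpow_zero_one hp h⟩

/-- The integral `∫₀ʷ log s / (s - 1) ds`, which is `log w * log (1 - w) + Li₂(w)`. -/
noncomputable def logDilog (w : ℝ) : ℝ := ∫ s in (0 : ℝ)..w, log s / (s - 1)

lemma logDilog_zero : logDilog 0 = 0 := intervalIntegral.integral_same

lemma logDilog_one : logDilog 1 = π ^ 2 / 6 := integral_log_div_sub_one

lemma continuousOn_logDilog : ContinuousOn logDilog (Icc 0 1) := by
  rw [← uIcc_of_le zero_le_one]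
  exact intervalIntegral.continuousOn_primitive_interval' intervalIntegrable_log_div_sub_one
    left_mem_uIcc

lemma hasDerivAt_primitive_Ioo {f : ℝ → ℝ} (hf : IntervalIntegrable f volume 0 1)
    (hc : ContinuousOn f (Ioo 0 1)) {w : ℝ} (hw : w ∈ Ioo (0 : ℝ) 1) :
    HasDerivAt (fun w => ∫ s in (0 : ℝ)..w, f s) (f w) w := by
  refine intervalIntegral.integral_hasDerivAt_right (hf.mono_set ?_)
    (hc.stronglyMeasurableAtFilter isOpen_Ioo w hw) (hc.continuousAt (Ioo_mem_nhds hw.1 hw.2))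
  rw [uIcc_of_le hw.1.le, uIcc_of_le zero_le_one]
  exact Icc_subset_Icc_right hw.2.le

lemma hasDerivAt_logDilog {w : ℝ} (hw : w ∈ Ioo (0 : ℝ) 1) :
    HasDerivAt logDilog (log w / (w - 1)) w := by
  refine hasDerivAt_primitive_Ioo intervalIntegrable_log_div_sub_one (fun s hs => ?_) hw
  have h0 : s ≠ 0 := hs.1.ne'
  have h1 : s - 1 ≠ 0 := by linarith [hs.2]
  exact ((continuousAt_log h0).div (by fun_prop) h1).continuousWithinAt

lemma hasDerivAt_logDilog_comp {B : ℝ → ℝ} {B' t : ℝ} (ht : 0 < t) (hB : HasDerivAt B B' t)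
    (hB0 : 0 < B t) (hC0 : 0 < 1 + t - t * B t) :
    HasDerivAt (fun t => logDilog (t * B t / (1 + t)))
      ((log t + log (B t) - log (1 + t)) *
        ((1 - B t - t * B') / (1 + t - t * B t) - 1 / (1 + t))) t := by
  have hA : 0 < 1 + t := by linarith
  have hw : t * B t / (1 + t) ∈ Ioo (0 : ℝ) 1 :=
    ⟨by positivity, by rw [div_lt_one hA]; linarith⟩
  have hi : HasDerivAt (fun t => t * B t / (1 + t))
      (((1 * B t + t * B') * (1 + t) - t * B t * 1) / (1 + t) ^ 2) t :=
    ((hasDerivAt_id t).mul hB).div ((hasDerivAt_id t).const_add 1) hA.ne'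
  refine ((hasDerivAt_logDilog hw).comp t hi).congr_deriv ?_
  rw [log_div (by positivity) hA.ne', log_mul ht.ne' hB0.ne']
  have h1 : t * B t / (1 + t) - 1 = -(1 + t - t * B t) / (1 + t) := by
    field_simp
    ring
  rw [h1]
  field_simp
  ring

lemma continuousOn_logDilog_comp {B : ℝ → ℝ} (hB : ContinuousOn B (Icc 0 1))
    (hB0 : ∀ t ∈ Icc (0 : ℝ) 1, 0 ≤ B t) (hC0 : ∀ t ∈ Icc (0 : ℝ) 1, 0 ≤ 1 + t - t * B t) :
    ContinuousOn (fun t => logDilog (t * B t / (1 + t))) (Icc 0 1) := by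
  have hA : ∀ t ∈ Icc (0 : ℝ) 1, 0 < 1 + t := fun t ht => by linarith [ht.1]
  refine continuousOn_logDilog.comp
    ((continuousOn_id.mul hB).div (by fun_prop) fun t ht => (hA t ht).ne') fun t ht => ?_
  refine ⟨div_nonneg (mul_nonneg ht.1 (hB0 t ht)) (hA t ht).le, ?_⟩
  have := hC0 t ht
  change t * B t / (1 + t) ≤ 1
  rw [div_le_one (hA t ht)]
  linarith

lemma hasDerivAt_log_one_add_rpow {p t : ℝ} (ht : 0 < t) :
    HasDerivAt (fun t : ℝ => log (1 + t ^ p)) (p * t ^ (p - 1) / (1 + t ^ p)) t :=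
  ((hasDerivAt_rpow_const (Or.inl ht.ne')).const_add 1).log (one_add_rpow_pos ht.le).ne'

lemma hasDerivAt_log_one_sub_rpow {p t : ℝ} (hp : 0 < p) (ht : t ∈ Ioo (0 : ℝ) 1) :
    HasDerivAt (fun t : ℝ => log (1 - t ^ p)) (-(p * t ^ (p - 1)) / (1 - t ^ p)) t :=
  ((hasDerivAt_rpow_const (Or.inl ht.1.ne')).const_sub 1).log
    (one_sub_rpow_pos hp (Ioo_subset_Ico_self ht)).ne'

lemma hasDerivAt_log_one_add {t : ℝ} (ht : 0 < t) :
    HasDerivAt (fun t : ℝ => log (1 + t)) (1 / (1 + t)) t :=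
  ((hasDerivAt_id t).const_add 1).log (by simp only [id]; linarith)

lemma rpow_one_add' {t : ℝ} (ht : 0 ≤ t) {y : ℝ} (hy : 0 < y) : t ^ (1 + y) = t * t ^ y := by
  rcases eq_or_lt_of_le ht with rfl | h
  · rw [zero_rpow (by linarith), zero_mul]
  · rw [rpow_add h, rpow_one]

/-- The integral `∫₀¹ log (1 - t ^ x) / (1 + t) dt`. -/
noncomputable def Lfun (x : ℝ) : ℝ := ∫ t in (0 : ℝ)..1, log (1 - t ^ x) / (1 + t)

lemma Lfun_two_mul {x : ℝ} (hx : 0 < x) : Lfun (2 * x) = Lfun x + Jfun x := by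
  rw [Lfun, Lfun, Jfun, ← intervalIntegral.integral_add
    (intervalIntegrable_log_one_sub_rpow hx).div_one_add
    (intervalIntegrable_log_one_add_rpow hx).div_one_add]
  refine intervalIntegral.integral_congr_Ioo_of_le zero_le_one fun t ht => ?_
  have h1 := one_sub_rpow_pos hx (Ioo_subset_Ico_self ht)
  have h2 := one_add_rpow_pos (p := x) ht.1.le
  rw [← add_div, ← log_mul h1.ne' h2.ne', mul_comm 2 x, rpow_mul ht.1.le, rpow_two]
  ring_nf

lemma Jfun_add_Jfun_inv {x : ℝ} (hx : 0 < x) : Jfun x + Jfun (1 / x) = log 2 ^ 2 := by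
  obtain ⟨hi, hv⟩ := mul_dlog_one_add_rpow (f := fun t => log (1 + t)) hx
    (intervalIntegrable_log_one_add_rpow (one_div_pos.2 hx)) fun t ht => by
      rw [one_div, rpow_rpow_inv ht.1.le hx.ne']
  rw [Jfun, Jfun, ← hv, ← intervalIntegral.integral_add
    (intervalIntegrable_log_one_add_rpow hx).div_one_add hi,
    intervalIntegral.integral_eq_sub_of_hasDerivAt_of_le
      (f := fun t => log (1 + t ^ x) * log (1 + t)) zero_le_one
      ((continuousOn_log_one_add_rpow hx).mul continuousOn_log_one_add) (fun t ht => ?_)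
      ((intervalIntegrable_log_one_add_rpow hx).div_one_add.add hi)]
  · norm_num
    ring
  · refine ((hasDerivAt_log_one_add_rpow (p := x) ht.1).mul
      (hasDerivAt_log_one_add ht.1)).congr_deriv ?_
    ring

/-- Three-term relation for `L`, coming from the five-term relation of the dilogarithm. -/
lemma Lfun_eq_Jfun_add_Lfun {y : ℝ} (hy : 0 < y) :
    Lfun y = Jfun (1 + y) + Lfun (y / (1 + y)) - log 2 ^ 2 / 2 + π ^ 2 / 12 * (y / (1 + y)) := by
  have hp : 0 < 1 + y := by linarith
  obtain ⟨i₁, v₁⟩ := mul_dlog_one_add_rpow (f := fun t => log (1 - t ^ y)) hp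
    (intervalIntegrable_log_one_sub_rpow (div_pos hy hp)) fun t ht => by
      rw [← rpow_mul ht.1.le, mul_div_cancel₀ _ hp.ne']
  obtain ⟨i₂, v₂⟩ := log_mul_dlog_one_add_rpow hp
  have i₃ := (intervalIntegrable_log_one_sub_rpow hy).div_one_add
  have i₄ := (intervalIntegrable_log_one_add_rpow hp).div_one_add
  have i₅ := intervalIntegrable_log_div_one_add
  have hint := (((i₃.sub i₄).sub i₁).sub i₂).add i₅
  have hcy := continuous_rpow_const hy.le
  have hcont : ContinuousOn (fun t : ℝ => -logDilog (t * (1 - t ^ y) / (1 + t)) +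
      log (1 + t) ^ 2 / 2 - log (1 + t) * log (1 + t ^ (1 + y))) (Icc 0 1) := by
    refine ((continuousOn_logDilog_comp (by fun_prop) (fun t ht => ?_) fun t ht => ?_).neg.add
      ((continuousOn_log_one_add.pow 2).div_const 2)).sub
      (continuousOn_log_one_add.mul (continuousOn_log_one_add_rpow hp))
    · exact sub_nonneg.2 (rpow_le_one ht.1 ht.2 hy.le)
    · have := mul_nonneg ht.1 (rpow_nonneg ht.1 y)
      linarith
  have hftc := intervalIntegral.integral_eq_sub_of_hasDerivAt_of_le zero_le_one hcont
    (fun t ht => ?_) hint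
  · rw [intervalIntegral.integral_add (((i₃.sub i₄).sub i₁).sub i₂) i₅,
      intervalIntegral.integral_sub ((i₃.sub i₄).sub i₁) i₂,
      intervalIntegral.integral_sub (i₃.sub i₄) i₁, intervalIntegral.integral_sub i₃ i₄,
      v₁, v₂, integral_log_div_one_add] at hftc
    simp only [one_rpow, sub_self, mul_zero, zero_div, logDilog_zero, zero_mul, add_zero,
      log_one, zero_rpow hp.ne'] at hftc
    norm_num at hftc
    rw [Lfun, Jfun, Lfun]
    have : π ^ 2 / 12 * (y / (1 + y)) = π ^ 2 / 12 - π ^ 2 / 12 / (1 + y) := by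
      field_simp
      ring
    rw [this]
    simp only [neg_div] at hftc
    linarith
  · have hb := one_sub_rpow_pos hy (Ioo_subset_Ico_self ht)
    have hc := one_add_rpow_pos (p := 1 + y) ht.1.le
    have hty := rpow_one_add' ht.1.le hy
    have htp : t ^ (1 + y - 1) = t ^ y := by ring_nf
    have htm : t * t ^ (y - 1) = t ^ y := by
      rw [rpow_sub_one ht.1.ne', mul_div_cancel₀ _ ht.1.ne']
    have hd := hasDerivAt_logDilog_comp (B := fun t => 1 - t ^ y) ht.1
      ((hasDerivAt_rpow_const (p := y) (Or.inl ht.1.ne')).const_sub 1) hb (by rw [hty] at hc; linarith)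
    have hA := hasDerivAt_log_one_add ht.1
    refine ((hd.neg.add ((hA.pow 2).div_const 2)).sub
      (hA.mul (hasDerivAt_log_one_add_rpow (p := 1 + y) ht.1))).congr_deriv ?_
    have e1 : 1 + t - t * (1 - t ^ y) = 1 + t ^ (1 + y) := by rw [hty]; ring
    have e2 : 1 - (1 - t ^ y) - t * -(y * t ^ (y - 1)) = (1 + y) * t ^ (1 + y - 1) := by
      rw [htp, ← htm]; ring
    rw [e1, e2]
    ring

/-- Three-term relation for `J`, coming from the five-term relation of the dilogarithm. -/
lemma Jfun_eq_Lfun_sub_Lfun {y : ℝ} (hy : 0 < y) :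
    Jfun y = Lfun (1 + y) - Lfun ((1 + y) / y) + log 2 ^ 2 / 2 - π ^ 2 / 12 +
      π ^ 2 / 6 / (1 + y) := by
  have hp : 0 < 1 + y := by linarith
  obtain ⟨i₁, v₁⟩ := mul_dlog_one_add_rpow (f := fun t => log (1 - t ^ (1 + y))) hy
    (intervalIntegrable_log_one_sub_rpow (div_pos hp hy)) fun t ht => by
      rw [← rpow_mul ht.1.le, mul_div_cancel₀ _ hy.ne']
  obtain ⟨i₂, v₂⟩ := log_mul_dlog_one_sub_rpow hp
  have i₃ := (intervalIntegrable_log_one_add_rpow hy).div_one_add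
  have i₄ := (intervalIntegrable_log_one_sub_rpow hp).div_one_add
  have i₅ := intervalIntegrable_log_div_one_add
  have hint := (((i₃.sub i₄).add i₁).sub i₂).add i₅
  have hcy := continuous_rpow_const hy.le
  have hg : DifferentiableAt ℝ (fun t : ℝ => log (1 + t ^ y) - log (1 + t)) 1 :=
    ((hasDerivAt_log_one_add_rpow one_pos).sub (hasDerivAt_log_one_add one_pos)).differentiableAt
  have hcont : ContinuousOn (fun t : ℝ => -logDilog (t * (1 + t ^ y) / (1 + t)) +
      log (1 + t) ^ 2 / 2 + (log (1 + t ^ y) - log (1 + t)) * log (1 - t ^ (1 + y)))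
      (Icc 0 1) := by
    refine ((continuousOn_logDilog_comp (by fun_prop) (fun t ht => ?_) fun t ht => ?_).neg.add
      ((continuousOn_log_one_add.pow 2).div_const 2)).add
      (continuousOn_mul_log_one_sub_rpow hp
        ((continuousOn_log_one_add_rpow hy).sub continuousOn_log_one_add) hg (by norm_num))
    · exact (one_add_rpow_pos ht.1).le
    · have h := rpow_le_one ht.1 ht.2 hp.le
      rw [rpow_one_add' ht.1 hy] at h
      linarith
  have hftc := intervalIntegral.integral_eq_sub_of_hasDerivAt_of_le zero_le_one hcont
    (fun t ht => ?_) hint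
  · rw [intervalIntegral.integral_add (((i₃.sub i₄).add i₁).sub i₂) i₅,
      intervalIntegral.integral_sub ((i₃.sub i₄).add i₁) i₂,
      intervalIntegral.integral_add (i₃.sub i₄) i₁, intervalIntegral.integral_sub i₃ i₄,
      v₁, v₂, integral_log_div_one_add] at hftc
    have h2 : (1 : ℝ) * (1 + 1) / (1 + 1) = 1 := by norm_num
    simp only [one_rpow, sub_self, zero_mul, zero_div, logDilog_zero, add_zero, h2,
      logDilog_one, log_one, zero_rpow hy.ne'] at hftc
    norm_num at hftc
    rw [Lfun, Jfun, Lfun]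
    linarith
  · have hb := one_add_rpow_pos (p := y) ht.1.le
    have hc := one_sub_rpow_pos hp (Ioo_subset_Ico_self ht)
    have hty := rpow_one_add' ht.1.le hy
    have htp : t ^ (1 + y - 1) = t ^ y := by ring_nf
    have htm : t * t ^ (y - 1) = t ^ y := by
      rw [rpow_sub_one ht.1.ne', mul_div_cancel₀ _ ht.1.ne']
    have hd := hasDerivAt_logDilog_comp (B := fun t => 1 + t ^ y) ht.1
      ((hasDerivAt_rpow_const (p := y) (Or.inl ht.1.ne')).const_add 1) hb
      (by rw [hty] at hc; linarith)
    have hA := hasDerivAt_log_one_add ht.1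
    refine ((hd.neg.add ((hA.pow 2).div_const 2)).add
      (((hasDerivAt_log_one_add_rpow (p := y) ht.1).sub hA).mul
        (hasDerivAt_log_one_sub_rpow hp ht))).congr_deriv ?_
    have e1 : 1 + t - t * (1 + t ^ y) = 1 - t ^ (1 + y) := by rw [hty]; ring
    have e2 : 1 - (1 + t ^ y) - t * (y * t ^ (y - 1)) = -((1 + y) * t ^ (1 + y - 1)) := by
      rw [htp, ← htm]; ring
    rw [e1, e2]
    simp only [Pi.sub_apply]
    ring

/-- Reflection formula for `L`. -/
lemma Lfun_sub_Lfun_two_div {y : ℝ} (hy : 0 < y) :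
    Lfun y - Lfun (2 / y) = log 2 * log y - log 2 ^ 2 / 2 := by
  obtain ⟨i₁, v₁⟩ := mul_dlog_one_add_rpow (f := fun t => log (1 - t ^ (2 : ℝ))) hy
    (intervalIntegrable_log_one_sub_rpow (div_pos two_pos hy)) fun t ht => by
      rw [← rpow_mul ht.1.le, mul_div_cancel₀ _ hy.ne']
  have i₂ := (intervalIntegrable_log_one_sub_rpow hy).div_one_add
  set r : ℝ → ℝ := dslope (fun t => log (rpowQuot y t)) 1 with hr
  have hqd : DifferentiableAt ℝ (fun t => log (rpowQuot y t)) 1 :=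
    (differentiableAt_rpowQuot y).log (by rw [rpowQuot_one]; exact hy.ne')
  have hrc : ContinuousOn r (Icc 0 1) := continuousOn_dslope_Icc (continuousOn_log_rpowQuot hy) hqd
  have hri : IntervalIntegrable r volume 0 1 := by
    rw [← uIcc_of_le zero_le_one] at hrc
    exact hrc.intervalIntegrable
  have hr_of_lt {t : ℝ} (ht : t ∈ Ico (0 : ℝ) 1) :
      r t = (log (1 - t ^ y) - log (1 - t) - log y) / (t - 1) := by
    rw [hr, dslope_of_ne _ ht.2.ne, slope_def_field, log_rpowQuot hy ht, rpowQuot_one]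
  set R : ℝ → ℝ := fun w => ∫ s in (0 : ℝ)..w, r s with hR
  have hRc : ContinuousOn R (Icc 0 1) := by
    rw [← uIcc_of_le zero_le_one]
    exact intervalIntegral.continuousOn_primitive_interval' hri left_mem_uIcc
  have hRd {t : ℝ} (ht : t ∈ Ioo (0 : ℝ) 1) : HasDerivAt R (r t) t :=
    hasDerivAt_primitive_Ioo hri (hrc.mono Ioo_subset_Icc_self) ht
  have hsq {t : ℝ} (ht : t ∈ Ioo (0 : ℝ) 1) : t ^ 2 ∈ Ioo (0 : ℝ) 1 :=
    ⟨pow_pos ht.1 2, pow_lt_one₀ ht.1.le ht.2 two_ne_zero⟩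
  have hg : DifferentiableAt ℝ (fun t : ℝ => log (1 + t) - log (1 + t ^ y)) 1 :=
    ((hasDerivAt_log_one_add one_pos).sub (hasDerivAt_log_one_add_rpow one_pos)).differentiableAt
  have cA := continuousOn_log_one_add
  have cB := continuousOn_log_one_add_rpow hy
  have hcont : ContinuousOn (fun t : ℝ => log (1 + t) ^ 2 / 2 +
      (log (1 + t) - log (1 + t ^ y)) * log (1 - t ^ (1 : ℝ)) + (R (t ^ 2) - R t) +
      log y * log (1 + t) - log (1 + t) * log (1 + t ^ y)) (Icc 0 1) := by
    refine ((((((cA.pow 2).div_const 2).add (continuousOn_mul_log_one_sub_rpow one_pos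
      (cA.sub cB) hg (by norm_num))).add ((hRc.comp (by fun_prop) fun t ht => ?_).sub hRc)).add
      (continuousOn_const.mul cA)).sub (cA.mul cB))
    exact ⟨pow_nonneg ht.1 2, pow_le_one₀ ht.1 ht.2⟩
  have hftc := intervalIntegral.integral_eq_sub_of_hasDerivAt_of_le zero_le_one hcont
    (fun t ht => ?_) (i₂.sub i₁)
  · rw [intervalIntegral.integral_sub i₂ i₁, v₁] at hftc
    norm_num [zero_rpow hy.ne'] at hftc
    rw [Lfun, Lfun, hftc]
    ring
  · have h1 : 1 - t ≠ 0 := by linarith [ht.2]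
    have h2 : 1 + t ≠ 0 := by linarith [ht.1]
    have h3 : t - 1 ≠ 0 := by linarith [ht.2]
    have hb := one_sub_rpow_pos hy (Ioo_subset_Ico_self ht)
    have hB := one_add_rpow_pos (p := y) ht.1.le
    have hA := hasDerivAt_log_one_add ht.1
    have hB' := hasDerivAt_log_one_add_rpow (p := y) ht.1
    refine ((((((hA.pow 2).div_const 2).add ((hA.sub hB').mul
      (hasDerivAt_log_one_sub_rpow one_pos ht))).add
      ((HasDerivAt.comp (h := fun t : ℝ => t ^ 2) t (hRd (hsq ht)) (hasDerivAt_pow 2 t)).sub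
        (hRd ht))).add
      (hA.const_mul (log y))).sub (hA.mul hB')).congr_deriv ?_
    have l1 : log (1 - t ^ 2) = log (1 - t) + log (1 + t) := by
      rw [← log_mul h1 h2]
      ring_nf
    have l2 : log (1 - (t ^ 2) ^ y) = log (1 - t ^ y) + log (1 + t ^ y) := by
      rw [← log_mul hb.ne' hB.ne', ← rpow_natCast, ← rpow_mul ht.1.le, mul_comm, rpow_mul ht.1.le,
        rpow_natCast]
      ring_nf
    have h4 : t ^ 2 - 1 = (t - 1) * (1 + t) := by ring
    have h5 : 1 - t = -(t - 1) := by ring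
    rw [hr_of_lt (Ioo_subset_Ico_self ht), hr_of_lt (Ioo_subset_Ico_self (hsq ht)), l2, rpow_two,
      l1, h4]
    simp only [Pi.sub_apply, rpow_one, sub_self, rpow_zero, Nat.cast_ofNat]
    generalize log (1 - t) = a
    rw [h5]
    field_simp
    ring

theorem J_four_add_sqrt_seventeen :
    Jfun (4 + Real.sqrt 17) =
      -(Real.pi ^ 2 / 6) + Real.log 2 ^ 2 / 2
        + Real.log 2 * Real.log (4 + Real.sqrt 17) := by
  have hs : √17 ^ 2 = 17 := sq_sqrt (by norm_num)
  have hs0 : 0 < √17 := sqrt_pos.2 (by norm_num)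
  set a : ℝ := (3 + √17) / 4 with ha
  set b : ℝ := (5 + √17) / 4 with hb
  have ha0 : 0 < a := by positivity
  have hb0 : 0 < b := by positivity
  have hx0 : 0 < 4 + √17 := by positivity
  have hab : b = a + 1 / 2 := by rw [ha, hb]; ring
  have hxab : 4 + √17 = 2 * b * a := by rw [ha, hb]; nlinarith
  have e1 := Jfun_eq_Lfun_sub_Lfun hx0
  have h1 : 1 + (4 + √17) = 2 * (2 * b) := by rw [hb]; ring
  have h2 : 2 * (2 * b) / (4 + √17) = 2 * (1 / a) := by rw [hxab]; field_simp
  rw [h1, h2, Lfun_two_mul (x := 2 * b) (by positivity),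
    Lfun_two_mul (x := 1 / a) (by positivity)] at e1
  have e2 := Lfun_sub_Lfun_two_div (y := 2 * b) (by positivity)
  rw [show 2 / (2 * b) = 1 / b by field_simp] at e2
  have e3 := Lfun_sub_Lfun_two_div (y := 2 * a) (by positivity)
  rw [show 2 / (2 * a) = 1 / a by field_simp] at e3
  have e4 := Lfun_eq_Jfun_add_Lfun (y := 2 * a) (by positivity)
  rw [show 1 + 2 * a = 2 * b by rw [hab]; ring, show 2 * a / (2 * b) = a / b by field_simp] at e4
  have e5 := Lfun_eq_Jfun_add_Lfun (y := a / b) (by positivity)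
  have h4 : 1 + a / b = a := by
    rw [ha, hb]
    field_simp
    nlinarith
  have h5 : a / b / (1 + a / b) = 1 / b := by
    rw [h4]
    field_simp
  rw [h5, h4] at e5
  have e6 := Jfun_add_Jfun_inv ha0
  have l1 : log (4 + √17) = log (2 * b) + log a := by rw [hxab, log_mul (by positivity) ha0.ne']
  have l2 : log (2 * a) = log 2 + log a := log_mul two_ne_zero ha0.ne'
  have h6 : 1 / b = 2 - 2 * (a / b) := by rw [hab]; field_simp; ring
  have h7 : π ^ 2 * (1 / b) = 2 * π ^ 2 - 2 * (π ^ 2 * (a / b)) := by rw [h6]; ring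
  have h8 : π ^ 2 / 6 / (2 * (2 * b)) = π ^ 2 / 24 * (1 / b) := by field_simp; norm_num
  rw [h8] at e1
  rw [l2] at e3
  rw [l1]
  linarith
end

section
/- J(2/5) = 11π²/240 + 3(log 2)²/4 − 2·log²((√5+1)/2). -/
open Real MeasureTheory

open Filter Topology Set

/-- The dilogarithm `∑ xⁿ / n²`. -/
noncomputable def dilog (x : ℝ) : ℝ := ∑' n : ℕ, x ^ (n + 1) / ((n : ℝ) + 1) ^ 2

lemma hasSum_inv_succ_sq : HasSum (fun n : ℕ => 1 / ((n : ℝ) + 1) ^ 2) (π ^ 2 / 6) := by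
  have h := (hasSum_nat_add_iff' 1).2 hasSum_zeta_two
  simpa using h

lemma dilog_zero : dilog 0 = 0 := by simp [dilog]

lemma dilog_one : dilog 1 = π ^ 2 / 6 := by
  simpa [dilog] using hasSum_inv_succ_sq.tsum_eq

lemma norm_dilog_term_le {x : ℝ} (hx : x ∈ Icc (-1 : ℝ) 1) (n : ℕ) :
    ‖x ^ (n + 1) / ((n : ℝ) + 1) ^ 2‖ ≤ 1 / ((n : ℝ) + 1) ^ 2 := by
  rw [norm_div, norm_pow, Real.norm_eq_abs, Real.norm_eq_abs,
    abs_of_nonneg (by positivity : (0 : ℝ) ≤ (n + 1) ^ 2)]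
  gcongr
  exact pow_le_one₀ (abs_nonneg x) (abs_le.2 hx)

lemma continuousOn_dilog : ContinuousOn dilog (Icc (-1) 1) :=
  continuousOn_tsum (fun n => by fun_prop) hasSum_inv_succ_sq.summable
    fun n _ hx => norm_dilog_term_le hx n

lemma hasDerivAt_dilog {x : ℝ} (hx : x ∈ Ioo (-1 : ℝ) 1) (h0 : x ≠ 0) :
    HasDerivAt dilog (-Real.log (1 - x) / x) x := by
  have habs : |x| < 1 := abs_lt.2 hx
  obtain ⟨r, hxr, hr⟩ := exists_between habs
  have hr0 : 0 ≤ r := (abs_nonneg x).trans hxr.le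
  have h := hasDerivAt_tsum_of_isPreconnected
    (g := fun (n : ℕ) (y : ℝ) => y ^ (n + 1) / ((n : ℝ) + 1) ^ 2)
    (g' := fun (n : ℕ) (y : ℝ) => y ^ n / ((n : ℝ) + 1))
    (t := Metric.ball (0 : ℝ) r) (y₀ := 0) (y := x) (summable_geometric_of_lt_one hr0 hr)
    Metric.isOpen_ball (convex_ball _ _).isPreconnected
    (fun n y _ => by
      have := (hasDerivAt_pow (n + 1) y).div_const (((n : ℝ) + 1) ^ 2)
      refine this.congr_deriv ?_
      push_cast
      field_simp)
    (fun n y hy => by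
      rw [norm_div, norm_pow, Real.norm_eq_abs, Real.norm_eq_abs,
        abs_of_nonneg (by positivity : (0 : ℝ) ≤ n + 1)]
      have hy' : |y| ≤ r := by simpa using (mem_ball_zero_iff.1 hy).le
      calc |y| ^ n / ((n : ℝ) + 1) ≤ |y| ^ n :=
            div_le_self (by positivity) (by linarith [(Nat.cast_nonneg n : (0 : ℝ) ≤ n)])
        _ ≤ r ^ n := by gcongr)
    (by simpa using (abs_nonneg x).trans_lt hxr)
    (by simp)
    (by simpa using hxr)
  have hs := (Real.hasSum_pow_div_log_of_abs_lt_one habs).div_const x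
  have hs' : ∑' n : ℕ, x ^ n / ((n : ℝ) + 1) = -Real.log (1 - x) / x := by
    rw [← hs.tsum_eq]
    refine tsum_congr fun n => ?_
    rw [pow_succ]
    field_simp
  rw [← hs']
  exact h

lemma continuousAt_log_mul {f : ℝ → ℝ} (hf : DifferentiableAt ℝ f 0) (h0 : f 0 = 0) :
    ContinuousAt (fun x => Real.log x * f x) 0 := by
  have hO : f =O[𝓝 0] fun x => x := by simpa [h0] using hf.isBigO_sub
  have ht : Tendsto (fun x : ℝ => Real.log x * x) (𝓝 0) (𝓝 0) := by
    have := Real.continuous_mul_log.tendsto 0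
    simpa [mul_comm] using this
  have := ((Asymptotics.isBigO_refl Real.log (𝓝 0)).mul hO).trans_tendsto ht
  simpa [ContinuousAt, h0] using this

lemma eq_of_hasDerivAt_zero {f : ℝ → ℝ} {a b : ℝ} (hab : a < b) (hc : ContinuousOn f (Icc a b))
    (hd : ∀ x ∈ Ioo a b, HasDerivAt f 0 x) : f b = f a := by
  obtain ⟨c, -, h⟩ := exists_hasDerivAt_eq_slope f (fun _ => 0) hab hc hd
  have := sub_pos.2 hab
  field_simp at h
  linarith

lemma dilog_add_dilog_neg {x : ℝ} (h0 : 0 < x) (h1 : x ≤ 1) :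
    dilog x + dilog (-x) = dilog (x ^ 2) / 2 := by
  have key := eq_of_hasDerivAt_zero (f := fun y => dilog y + dilog (-y) - dilog (y ^ 2) / 2) h0
    (by
      refine ((continuousOn_dilog.comp continuousOn_id ?_).add
        (continuousOn_dilog.comp continuousOn_neg ?_)).sub
        ((continuousOn_dilog.comp (continuousOn_pow 2) ?_).div_const 2)
      · exact fun y hy => ⟨neg_one_lt_zero.le.trans hy.1, hy.2.trans h1⟩
      all_goals
        rintro y ⟨hy0, hy1⟩
        constructor <;> nlinarith)
    (by
      rintro y ⟨hy0, hy1⟩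
      have hy : y < 1 := hy1.trans_le h1
      have d1 := hasDerivAt_dilog (x := y) ⟨by linarith, hy⟩ hy0.ne'
      have d2 := (hasDerivAt_dilog (x := -y) ⟨by linarith, by linarith⟩ (by linarith)).comp y
        (hasDerivAt_neg y)
      have d3 := (hasDerivAt_dilog (x := y ^ 2) ⟨by nlinarith, by nlinarith⟩ (by positivity)).comp y
        (hasDerivAt_pow 2 y)
      refine HasDerivAt.congr_deriv ((d1.add d2).sub (d3.div_const 2)) ?_
      have hl : Real.log (1 - y ^ 2) = Real.log (1 - y) + Real.log (1 + y) := by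
        rw [← Real.log_mul (by linarith) (by linarith)]
        ring_nf
      rw [hl, sub_neg_eq_add]
      field_simp
      ring)
  simp [dilog_zero] at key
  linarith

lemma dilog_neg_one : dilog (-1) = -π ^ 2 / 12 := by
  have := dilog_add_dilog_neg one_pos le_rfl
  rw [one_pow, dilog_one] at this
  linarith

/-- Landen's identity. -/
lemma dilog_add_dilog_landen {x : ℝ} (h0 : 0 < x) (h1 : x ≤ 1 / 2) :
    dilog x + dilog (-(x / (1 - x))) = -Real.log (1 - x) ^ 2 / 2 := by
  have key := eq_of_hasDerivAt_zero
    (f := fun y => dilog y + dilog (-(y / (1 - y))) + Real.log (1 - y) ^ 2 / 2) h0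
    (by
      refine ((continuousOn_dilog.comp continuousOn_id ?_).add
        (continuousOn_dilog.comp (f := fun y : ℝ => -(y / (1 - y))) ?_ ?_)).add ?_
      · rintro y ⟨hy0, hy1⟩
        constructor <;> simp only [id] <;> linarith
      · refine (continuousOn_id.div (by fun_prop) ?_).neg
        rintro y ⟨hy0, hy1⟩
        linarith
      · rintro y ⟨hy0, hy1⟩
        have : 0 < 1 - y := by linarith
        constructor
        · rw [neg_le_neg_iff, div_le_one this]
          linarith
        · have : 0 ≤ y / (1 - y) := by positivity
          linarith
      · refine ((ContinuousOn.log (by fun_prop) ?_).pow 2).div_const 2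
        rintro y ⟨hy0, hy1⟩
        linarith)
    (by
      rintro y ⟨hy0, hy1⟩
      have hp : 0 < 1 - y := by linarith
      have hq : 0 < y / (1 - y) := by positivity
      have hq1 : y / (1 - y) < 1 := by rw [div_lt_one hp]; linarith
      have ds : HasDerivAt (fun y : ℝ => 1 - y) (-1) y := (hasDerivAt_id y).const_sub 1
      have d1 := hasDerivAt_dilog (x := y) ⟨by linarith, by linarith⟩ hy0.ne'
      have d2 := (hasDerivAt_dilog (x := -(y / (1 - y))) ⟨by linarith, by linarith⟩
        (by linarith)).comp y ((hasDerivAt_id y).div ds hp.ne').neg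
      have d3 := ((ds.log hp.ne').pow 2).div_const 2
      refine HasDerivAt.congr_deriv ((d1.add d2).add d3) ?_
      have hl : Real.log (1 - -(y / (1 - y))) = -Real.log (1 - y) := by
        rw [← Real.log_inv]
        congr 1
        field_simp
        ring
      rw [hl]
      simp only [id]
      field_simp
      ring)
  simp [dilog_zero] at key
  linarith

/-- Euler's reflection formula. -/
lemma dilog_add_dilog_one_sub {x : ℝ} (h0 : 0 < x) (h1 : x < 1) :
    dilog x + dilog (1 - x) = π ^ 2 / 6 - Real.log x * Real.log (1 - x) := by
  have key := eq_of_hasDerivAt_zero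
    (f := fun y => dilog y + dilog (1 - y) + Real.log y * Real.log (1 - y)) h0
    (by
      refine ((continuousOn_dilog.comp continuousOn_id ?_).add
        (continuousOn_dilog.comp (f := fun y : ℝ => 1 - y) (by fun_prop) ?_)).add ?_
      · rintro y ⟨hy0, hy1⟩
        constructor <;> simp only [id] <;> linarith
      · rintro y ⟨hy0, hy1⟩
        constructor <;> linarith
      · rintro y ⟨hy0, hy1⟩
        apply ContinuousAt.continuousWithinAt
        rcases hy0.eq_or_lt with rfl | hy
        · apply continuousAt_log_mul
          · exact DifferentiableAt.log (by fun_prop) (by norm_num)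
          · simp
        · exact (continuousAt_id.log hy.ne').mul
            (ContinuousAt.log (by fun_prop) (by linarith)))
    (by
      rintro y ⟨hy0, hy1⟩
      have hp : 0 < 1 - y := by linarith
      have ds : HasDerivAt (fun y : ℝ => 1 - y) (-1) y := (hasDerivAt_id y).const_sub 1
      have d1 := hasDerivAt_dilog (x := y) ⟨by linarith, by linarith⟩ hy0.ne'
      have d2 := (hasDerivAt_dilog (x := 1 - y) ⟨by linarith, by linarith⟩ hp.ne').comp y ds
      have d3 := (Real.hasDerivAt_log hy0.ne').mul (ds.log hp.ne')
      refine HasDerivAt.congr_deriv ((d1.add d2).add d3) ?_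
      rw [sub_sub_cancel]
      field_simp
      ring)
  simp [dilog_zero, dilog_one] at key
  linarith

/-- The functional equation of Legendre's chi function `(dilog x - dilog (-x)) / 2`. -/
lemma dilog_sub_dilog_neg_add {x : ℝ} (h0 : 0 < x) (h1 : x < 1) :
    dilog x - dilog (-x) + (dilog ((1 - x) / (1 + x)) - dilog (-((1 - x) / (1 + x)))) =
      π ^ 2 / 4 + Real.log x * (Real.log (1 + x) - Real.log (1 - x)) := by
  have hmem : ∀ y ∈ Icc 0 x, (1 - y) / (1 + y) ∈ Icc (0 : ℝ) 1 := by
    rintro y ⟨hy0, hy1⟩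
    have hp : 0 < 1 - y := by linarith
    have hq : 0 < 1 + y := by linarith
    exact ⟨by positivity, by rw [div_le_one hq]; linarith⟩
  have hcont : ContinuousOn (fun y : ℝ => (1 - y) / (1 + y)) (Icc 0 x) :=
    ContinuousOn.div (by fun_prop) (by fun_prop) (fun y hy => by linarith [hy.1])
  have key := eq_of_hasDerivAt_zero
    (f := fun y => dilog y - dilog (-y) +
      (dilog ((1 - y) / (1 + y)) - dilog (-((1 - y) / (1 + y)))) -
      Real.log y * (Real.log (1 + y) - Real.log (1 - y))) h0
    (by
      refine (((continuousOn_dilog.comp continuousOn_id ?_).sub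
        (continuousOn_dilog.comp continuousOn_neg ?_)).add
        ((continuousOn_dilog.comp hcont ?_).sub (continuousOn_dilog.comp hcont.neg ?_))).sub ?_
      · rintro y ⟨hy0, hy1⟩
        constructor <;> simp only [id] <;> linarith
      · rintro y ⟨hy0, hy1⟩
        constructor <;> linarith
      · intro y hy
        have := hmem y hy
        exact ⟨by linarith [this.1], this.2⟩
      · intro y hy
        have := hmem y hy
        exact ⟨neg_le_neg this.2, (neg_nonpos.2 this.1).trans zero_le_one⟩
      · rintro y ⟨hy0, hy1⟩
        apply ContinuousAt.continuousWithinAt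
        rcases hy0.eq_or_lt with rfl | hy
        · apply continuousAt_log_mul
          · exact (DifferentiableAt.log (by fun_prop) (by norm_num)).sub
              (DifferentiableAt.log (by fun_prop) (by norm_num))
          · simp
        · exact (continuousAt_id.log hy.ne').mul
            ((ContinuousAt.log (by fun_prop) (by linarith)).sub
              (ContinuousAt.log (by fun_prop) (by linarith))))
    (by
      rintro y ⟨hy0, hy1⟩
      have hp : 0 < 1 - y := by linarith
      have hq : 0 < 1 + y := by linarith
      have hw : 0 < (1 - y) / (1 + y) := by positivity
      have hw1 : (1 - y) / (1 + y) < 1 := by rw [div_lt_one hq]; linarith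
      have ds : HasDerivAt (fun y : ℝ => 1 - y) (-1) y := (hasDerivAt_id y).const_sub 1
      have da : HasDerivAt (fun y : ℝ => 1 + y) 1 y := (hasDerivAt_id y).const_add 1
      have dw := ds.div da hq.ne'
      have d1 := hasDerivAt_dilog (x := y) ⟨by linarith, by linarith⟩ hy0.ne'
      have d2 := (hasDerivAt_dilog (x := -y) ⟨by linarith, by linarith⟩ (by linarith)).comp y
        (hasDerivAt_neg y)
      have d3 := (hasDerivAt_dilog (x := (1 - y) / (1 + y)) ⟨by linarith, by linarith⟩
        hw.ne').comp y dw
      have d4 := (hasDerivAt_dilog (x := -((1 - y) / (1 + y))) ⟨by linarith, by linarith⟩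
        (by linarith)).comp y dw.neg
      have d5 := (Real.hasDerivAt_log hy0.ne').mul ((da.log hq.ne').sub (ds.log hp.ne'))
      refine HasDerivAt.congr_deriv (((d1.sub d2).add (d3.sub d4)).sub d5) ?_
      have hl1 : Real.log (1 - (1 - y) / (1 + y)) =
          Real.log 2 + Real.log y - Real.log (1 + y) := by
        rw [← Real.log_mul two_ne_zero hy0.ne', ← Real.log_div (by positivity) hq.ne']
        congr 1
        field_simp
        ring
      have hl2 : Real.log (1 - -((1 - y) / (1 + y))) = Real.log 2 - Real.log (1 + y) := by
        rw [← Real.log_div two_ne_zero hq.ne']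
        congr 1
        field_simp
        ring
      rw [hl1, hl2, sub_neg_eq_add]
      simp only [Pi.sub_apply]
      field_simp
      ring)
  simp [dilog_zero, dilog_one, dilog_neg_one] at key
  linarith

/-- Here `a` is the inverse of the golden ratio. -/
lemma dilog_golden_half {a : ℝ} (h0 : 0 < a) (ha : a ^ 2 = 1 - a) :
    dilog ((1 + a) / 2) + dilog (-(a / 2)) =
      π ^ 2 / 12 + 2 * Real.log a ^ 2 - Real.log 2 ^ 2 := by
  have hlo : 1 / 2 < a := by nlinarith
  have hhi : a < 2 / 3 := by nlinarith
  have hcube : a ^ 3 = 2 * a - 1 := by linear_combination (a - 1) * ha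
  have hl1 : Real.log (1 + a) = -Real.log a := by
    rw [← Real.log_inv]
    congr 1
    field_simp
    linarith
  have hl2 : Real.log (1 - a) = 2 * Real.log a := by
    rw [← ha, Real.log_pow]
    norm_num
  have e1 := dilog_add_dilog_one_sub h0 (by linarith)
  have e2 := dilog_add_dilog_landen (x := a ^ 2) (by positivity) (by linarith)
  have e3 := dilog_add_dilog_neg h0 (by linarith)
  have e4 := dilog_sub_dilog_neg_add h0 (by linarith)
  have e5 := dilog_add_dilog_landen (x := a ^ 2 / 2) (by positivity) (by linarith)
  have e6 := dilog_add_dilog_landen (x := a ^ 3) (by positivity) (by linarith)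
  have e7 := dilog_add_dilog_one_sub (x := (1 + a) / 2) (by linarith) (by linarith)
  have r2 : 1 - a ^ 2 = a := by linarith
  have r2' : a ^ 2 / a = a := by field_simp
  have r4 : (1 - a) / (1 + a) = a ^ 3 := by
    rw [div_eq_iff (by linarith)]
    linear_combination (-a - a ^ 2) * ha + (a - a ^ 2) * ha + (a ^ 2 - 1) * ha
  have r5 : 1 - a ^ 2 / 2 = (1 + a) / 2 := by linarith
  have r5' : a ^ 2 / 2 / ((1 + a) / 2) = a ^ 3 := by
    rw [← r4, ha]
    field_simp
  have r6 : 1 - a ^ 3 = 2 * a ^ 2 := by linarith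
  have r6' : a ^ 3 / (2 * a ^ 2) = a / 2 := by field_simp
  have r7 : 1 - (1 + a) / 2 = a ^ 2 / 2 := by linarith
  have l5 : Real.log ((1 + a) / 2) = -Real.log a - Real.log 2 := by
    rw [Real.log_div (by linarith) two_ne_zero, hl1]
  have l6 : Real.log (2 * a ^ 2) = Real.log 2 + 2 * Real.log a := by
    rw [Real.log_mul two_ne_zero (by positivity), Real.log_pow]
    norm_num
  have l7 : Real.log (a ^ 2 / 2) = 2 * Real.log a - Real.log 2 := by
    rw [Real.log_div (by positivity) two_ne_zero, Real.log_pow]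
    norm_num
  rw [hl2, ← ha] at e1
  rw [r2, r2'] at e2
  rw [r4, hl1, hl2] at e4
  rw [r5, r5', l5] at e5
  rw [r6, r6', l6] at e6
  rw [r7, l5, l7] at e7
  linarith

/-- An antiderivative of `5 u⁴ log (1 + u²) / (1 + u⁵)` on `[0, 1]` when `a² = 1 - a`. -/
noncomputable def antideriv (a u : ℝ) : ℝ :=
  Real.log (1 + u ^ 2) * Real.log (1 + u ^ 5) - 5 / 4 * Real.log (1 + u ^ 2) ^ 2
    - 5 / 4 * dilog (-u ^ 2) + 1 / 5 * dilog (-u ^ 5)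
    - 1 / 2 * dilog (-2 * (u / (1 + u ^ 2))) - dilog ((1 + a) * (u / (1 + u ^ 2)))
    - dilog (-a * (u / (1 + u ^ 2)))

lemma div_one_add_sq_mem {u : ℝ} (hu : u ∈ Icc (0 : ℝ) 1) :
    u / (1 + u ^ 2) ∈ Icc (0 : ℝ) (1 / 2) := by
  have h := hu.1
  refine ⟨by positivity, ?_⟩
  rw [div_le_div_iff₀ (by positivity) two_pos]
  nlinarith [sq_nonneg (u - 1)]

lemma continuousOn_antideriv {a : ℝ} (h0 : 0 < a) (h1 : a < 1) :
    ContinuousOn (antideriv a) (Icc 0 1) := by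
  have hv : ContinuousOn (fun u : ℝ => u / (1 + u ^ 2)) (Icc 0 1) :=
    ContinuousOn.div (by fun_prop) (by fun_prop) (fun u _ => by positivity)
  have hl2 : ContinuousOn (fun u : ℝ => Real.log (1 + u ^ 2)) (Icc 0 1) :=
    ContinuousOn.log (by fun_prop) (fun u _ => by positivity)
  have hl5 : ContinuousOn (fun u : ℝ => Real.log (1 + u ^ 5)) (Icc 0 1) :=
    ContinuousOn.log (by fun_prop) (fun u hu => by have := hu.1; positivity)
  have hD : ∀ f : ℝ → ℝ, ContinuousOn f (Icc 0 1) → (∀ u ∈ Icc (0 : ℝ) 1, f u ∈ Icc (-1 : ℝ) 1) →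
      ContinuousOn (fun u => dilog (f u)) (Icc 0 1) := fun f hf hm => continuousOn_dilog.comp hf hm
  have hpow : ∀ n : ℕ, ∀ u ∈ Icc (0 : ℝ) 1, -u ^ n ∈ Icc (-1 : ℝ) 1 := fun n u hu => by
    have h1 := pow_le_one₀ (n := n) hu.1 hu.2
    have h2 := pow_nonneg hu.1 n
    constructor <;> linarith
  have hlin : ∀ c ∈ Icc (-2 : ℝ) 2, ∀ u ∈ Icc (0 : ℝ) 1, c * (u / (1 + u ^ 2)) ∈
      Icc (-1 : ℝ) 1 := by
    rintro c ⟨hc1, hc2⟩ u hu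
    obtain ⟨hv1, hv2⟩ := div_one_add_sq_mem hu
    constructor <;> nlinarith
  exact ((((((hl2.mul hl5).sub ((hl2.pow 2).const_mul (5 / 4))).sub
    ((hD _ (by fun_prop) (hpow 2)).const_mul (5 / 4))).add
    ((hD _ (by fun_prop) (hpow 5)).const_mul (1 / 5))).sub
    ((hD _ (hv.const_mul (-2)) (hlin _ (by constructor <;> linarith))).const_mul (1 / 2))).sub
    (hD _ (hv.const_mul (1 + a)) (hlin _ (by constructor <;> linarith)))).sub
    (hD _ (hv.const_mul (-a)) (hlin _ (by constructor <;> linarith)))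

lemma log_factorization {a u : ℝ} (h0 : 0 < a) (ha : a ^ 2 = 1 - a) (hu : u ∈ Ioo (0 : ℝ) 1) :
    Real.log (1 - -2 * (u / (1 + u ^ 2))) / 2 + Real.log (1 - (1 + a) * (u / (1 + u ^ 2)))
      + Real.log (1 - -a * (u / (1 + u ^ 2))) =
    Real.log (1 + u ^ 5) - 5 / 2 * Real.log (1 + u ^ 2) := by
  obtain ⟨hu0, hu1⟩ := hu
  have h1 : a < 1 := by nlinarith
  obtain ⟨hv1, hv2⟩ := div_one_add_sq_mem ⟨hu0.le, hu1.le⟩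
  have p1 : 0 < 1 - -2 * (u / (1 + u ^ 2)) := by linarith
  have p2 : 0 < 1 - (1 + a) * (u / (1 + u ^ 2)) := by nlinarith
  have p3 : 0 < 1 - -a * (u / (1 + u ^ 2)) := by nlinarith
  have hprod : (1 - -2 * (u / (1 + u ^ 2))) *
      ((1 - (1 + a) * (u / (1 + u ^ 2))) * (1 - -a * (u / (1 + u ^ 2)))) ^ 2 * (1 + u ^ 2) ^ 5 =
      (1 + u ^ 5) ^ 2 := by
    have hq : (1 - (1 + a) * (u / (1 + u ^ 2))) * (1 - -a * (u / (1 + u ^ 2))) =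
        (1 - u + u ^ 2 - u ^ 3 + u ^ 4) / (1 + u ^ 2) ^ 2 := by
      field_simp
      linear_combination (-u ^ 2) * ha
    rw [hq]
    field_simp
    ring
  have hlog := congrArg Real.log hprod
  rw [Real.log_mul (by positivity) (by positivity), Real.log_mul (by positivity) (by positivity),
    Real.log_pow, Real.log_pow, Real.log_pow, Real.log_mul p2.ne' p3.ne'] at hlog
  push_cast at hlog
  linarith

lemma hasDerivAt_antideriv {a u : ℝ} (h0 : 0 < a) (ha : a ^ 2 = 1 - a) (hu : u ∈ Ioo (0 : ℝ) 1) :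
    HasDerivAt (antideriv a) (5 * u ^ 4 * Real.log (1 + u ^ 2) / (1 + u ^ 5)) u := by
  have hfac := log_factorization h0 ha hu
  obtain ⟨hu0, hu1⟩ := hu
  have h1 : a < 1 := by nlinarith
  have hv : u / (1 + u ^ 2) ∈ Ioo (0 : ℝ) (1 / 2) := by
    refine ⟨by positivity, ?_⟩
    rw [div_lt_div_iff₀ (by positivity) two_pos]
    nlinarith [sq_pos_of_neg (sub_neg.2 hu1)]
  have hp2 : u ^ 2 < 1 := pow_lt_one₀ hu0.le hu1 (by norm_num)
  have hp5 : u ^ 5 < 1 := pow_lt_one₀ hu0.le hu1 (by norm_num)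
  have hp2' : 0 < u ^ 2 := by positivity
  have hp5' : 0 < u ^ 5 := by positivity
  have dq : HasDerivAt (fun u : ℝ => 1 + u ^ 2) (2 * u) u := by
    simpa using (hasDerivAt_pow 2 u).const_add 1
  have dr : HasDerivAt (fun u : ℝ => 1 + u ^ 5) (5 * u ^ 4) u := by
    simpa using (hasDerivAt_pow 5 u).const_add 1
  have dv := (hasDerivAt_id u).div dq (by positivity)
  have dl2 := dq.log (by positivity)
  have dl5 := dr.log (by positivity)
  have e2 := (hasDerivAt_dilog (x := -u ^ 2) ⟨by linarith, by linarith⟩ (by linarith)).comp u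
    (hasDerivAt_pow 2 u).neg
  have e5 := (hasDerivAt_dilog (x := -u ^ 5) ⟨by linarith, by linarith⟩ (by linarith)).comp u
    (hasDerivAt_pow 5 u).neg
  have hlin : ∀ c ∈ Icc (-2 : ℝ) 2, c ≠ 0 → HasDerivAt (fun u : ℝ => dilog (c * (u / (1 + u ^ 2))))
      (-Real.log (1 - c * (u / (1 + u ^ 2))) * (1 / u - 2 * u / (1 + u ^ 2))) u := by
    rintro c ⟨hc1, hc2⟩ hc
    have := (hasDerivAt_dilog (x := c * (u / (1 + u ^ 2)))
      ⟨by nlinarith [hv.1, hv.2], by nlinarith [hv.1, hv.2]⟩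
      (mul_ne_zero hc hv.1.ne')).comp u (dv.const_mul c)
    refine this.congr_deriv ?_
    simp only [id]
    field_simp
  have c1 := hlin (-2) (by constructor <;> linarith) (by norm_num)
  have c2 := hlin (1 + a) (by constructor <;> linarith) (by linarith)
  have c3 := hlin (-a) (by constructor <;> linarith) (by linarith)
  refine HasDerivAt.congr_deriv (((((((dl2.mul dl5).sub ((dl2.pow 2).const_mul (5 / 4))).sub
    (e2.const_mul (5 / 4))).add (e5.const_mul (1 / 5))).sub (c1.const_mul (1 / 2))).sub c2).sub c3) ?_
  have hfac' : Real.log (1 - -a * (u / (1 + u ^ 2))) =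
      Real.log (1 + u ^ 5) - 5 / 2 * Real.log (1 + u ^ 2)
      - Real.log (1 - -2 * (u / (1 + u ^ 2))) / 2
      - Real.log (1 - (1 + a) * (u / (1 + u ^ 2))) := by linarith
  rw [hfac', sub_neg_eq_add, sub_neg_eq_add]
  push_cast
  field_simp
  ring

lemma antideriv_zero (a : ℝ) : antideriv a 0 = 0 := by simp [antideriv, dilog_zero]

lemma antideriv_one {a : ℝ} (h0 : 0 < a) (ha : a ^ 2 = 1 - a) :
    antideriv a 1 = 11 * π ^ 2 / 240 + 3 * Real.log 2 ^ 2 / 4 - 2 * Real.log a ^ 2 := by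
  have h := dilog_golden_half h0 ha
  have e1 : (1 + a) * (1 / (1 + 1 ^ 2)) = (1 + a) / 2 := by ring
  have e2 : -a * (1 / (1 + 1 ^ 2)) = -(a / 2) := by ring
  have e3 : (-2 : ℝ) * (1 / (1 + 1 ^ 2)) = -1 := by norm_num
  have e4 : (1 : ℝ) + 1 = 2 := by norm_num
  rw [antideriv, e1, e2, e3, one_pow, one_pow, e4, dilog_neg_one]
  linarith

/-- With `t = u⁵`, the integral is the increment of `antideriv a` over `[0, 1]`. -/
lemma Jfun_two_fifths_eq_antideriv {a : ℝ} (h0 : 0 < a) (ha : a ^ 2 = 1 - a) :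
    Jfun (2 / 5) = antideriv a 1 := by
  have h1 : a < 1 := by nlinarith
  have hroot : ContinuousOn (fun t : ℝ => t ^ (1 / 5 : ℝ)) (Icc 0 1) :=
    continuousOn_id.rpow_const fun _ _ => Or.inr (by norm_num)
  have hmaps : MapsTo (fun t : ℝ => t ^ (1 / 5 : ℝ)) (Icc 0 1) (Icc 0 1) := fun t ht =>
    ⟨Real.rpow_nonneg ht.1 _, Real.rpow_le_one ht.1 ht.2 (by norm_num)⟩
  have hint : IntervalIntegrable (fun t : ℝ => Real.log (1 + t ^ (2 / 5 : ℝ)) / (1 + t))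
      volume 0 1 := by
    apply ContinuousOn.intervalIntegrable
    rw [uIcc_of_le zero_le_one]
    refine ContinuousOn.div (ContinuousOn.log (continuousOn_const.add
      (continuousOn_id.rpow_const fun _ _ => Or.inr (by norm_num))) ?_) (by fun_prop) ?_
    · intro t ht
      have : 0 ≤ t ^ (2 / 5 : ℝ) := Real.rpow_nonneg ht.1 _
      positivity
    · intro t ht
      linarith [ht.1]
  have hderiv : ∀ t ∈ Ioo (0 : ℝ) 1, HasDerivAt (fun t => antideriv a (t ^ (1 / 5 : ℝ)))
      (Real.log (1 + t ^ (2 / 5 : ℝ)) / (1 + t)) t := by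
    rintro t ⟨ht0, ht1⟩
    have hu : t ^ (1 / 5 : ℝ) ∈ Ioo (0 : ℝ) 1 :=
      ⟨Real.rpow_pos_of_pos ht0 _, Real.rpow_lt_one ht0.le ht1 (by norm_num)⟩
    refine ((hasDerivAt_antideriv h0 ha hu).comp t
      (Real.hasDerivAt_rpow_const (Or.inl ht0.ne'))).congr_deriv ?_
    have p2 : (t ^ (1 / 5 : ℝ)) ^ 2 = t ^ (2 / 5 : ℝ) := by
      rw [← Real.rpow_mul_natCast ht0.le]
      norm_num
    have p5 : (t ^ (1 / 5 : ℝ)) ^ 5 = t := by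
      rw [← Real.rpow_mul_natCast ht0.le]
      norm_num
    have p4 : (t ^ (1 / 5 : ℝ)) ^ 4 * t ^ (1 / 5 - 1 : ℝ) = 1 := by
      rw [← Real.rpow_mul_natCast ht0.le, ← Real.rpow_add ht0]
      norm_num
    rw [p2, p5]
    linear_combination (Real.log (1 + t ^ (2 / 5 : ℝ)) / (1 + t)) * p4
  rw [Jfun, intervalIntegral.integral_eq_sub_of_hasDerivAt_of_le zero_le_one
    ((continuousOn_antideriv h0 h1).comp hroot hmaps) hderiv hint]
  simp [antideriv_zero]

theorem J_two_fifths :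
    Jfun (2 / 5) =
      11 * Real.pi ^ 2 / 240 + 3 * Real.log 2 ^ 2 / 4
        - 2 * Real.log ((Real.sqrt 5 + 1) / 2) ^ 2 := by
  have hs : √5 ^ 2 = 5 := Real.sq_sqrt (by norm_num)
  have hs0 : 2 < √5 := Real.lt_sqrt_of_sq_lt (by norm_num)
  have h0 : 0 < (√5 - 1) / 2 := by linarith
  have ha : ((√5 - 1) / 2) ^ 2 = 1 - (√5 - 1) / 2 := by linear_combination hs / 4
  have hinv : (√5 + 1) / 2 = ((√5 - 1) / 2)⁻¹ := by
    refine eq_inv_of_mul_eq_one_left ?_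
    linear_combination hs / 4
  rw [Jfun_two_fifths_eq_antideriv h0 ha, antideriv_one h0 ha, hinv, Real.log_inv, neg_sq]
end
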